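/- arXiv:2007.08731 — 3 statements merged into one kernel-verified Lean document; each statement's English description precedes it below -/
import Mathlib

section
/- Let k be a field of characteristic zero, V a vector superspace over k, and x an odd nilpotent endomorphism of V such that (V, x) is neat. Suppose (h, Y) and (h', Y') are two pairs, with h, h' even endomorphisms and Y, Y' odd endomorphisms of V, both satisfying the relations h∘x − x∘h = −2x, h∘Y − Y∘h = 2Y, Y∘x + x∘Y = h and h'∘x − x∘h' = −2x, h'∘Y' − Y'∘h' = 2Y', Y'∘x + x∘Y' = h'. Then there exists an even invertible endomorphism g of V with g∘x∘g⁻¹ = x, g∘h∘g⁻¹ = h', and g∘Y∘g⁻¹ = Y'. [Uniqueness up to conjugation in the super Jacobson–Morozov lemma, instance G = GL(V).] -/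
open scoped TensorProduct

section Defs

variable (k : Type*) [Field k]

def IsEvenMap {V : Type*} [AddCommGroup V] [Module k V]
    (V0 V1 : Submodule k V) (f : V →ₗ[k] V) : Prop :=
  (∀ v ∈ V0, f v ∈ V0) ∧ (∀ v ∈ V1, f v ∈ V1)

def IsOddMap {V : Type*} [AddCommGroup V] [Module k V]
    (V0 V1 : Submodule k V) (f : V →ₗ[k] V) : Prop :=
  (∀ v ∈ V0, f v ∈ V1) ∧ (∀ v ∈ V1, f v ∈ V0)

/-- The shift endomorphism of the string module `M_n`: sends basis vector `a_j` to `a_{j+1}`,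
and `a_n` to `0`.  In coordinates, `(x f) j = f (j-1)` for `j ≥ 1` and `(x f) 0 = 0`. -/
def shiftMap (n : ℕ) : (Fin (n+1) → k) →ₗ[k] (Fin (n+1) → k) where
  toFun f := fun j =>
    if (j : ℕ) = 0 then 0 else f ⟨(j : ℕ) - 1, Nat.lt_of_le_of_lt (Nat.sub_le _ _) j.isLt⟩
  map_add' f g := by funext j; simp only [Pi.add_apply]; split_ifs <;> simp
  map_smul' c f := by funext j; simp only [Pi.smul_apply, RingHom.id_apply]; split_ifs <;> simp

/-- The even (`r = 0`) resp. odd (`r = 1`) part of the string module `Π^ε M_n`: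
coordinates `j` with `(j + ε) % 2 = r`. -/
def stringPart (n ε r : ℕ) : Submodule k (Fin (n+1) → k) :=
  Submodule.pi Set.univ (fun j => if ((j : ℕ) + ε) % 2 = r then (⊤ : Submodule k k) else ⊥)

/-- Isomorphism of pairs (vector superspace with endomorphism): an even linear isomorphism
intertwining the endomorphisms. -/
def PairIso {V : Type*} [AddCommGroup V] [Module k V]
    (V0 V1 : Submodule k V) (x : V →ₗ[k] V)
    {W : Type*} [AddCommGroup W] [Module k W]
    (W0 W1 : Submodule k W) (y : W →ₗ[k] W) : Prop :=
  ∃ φ : V ≃ₗ[k] W, (∀ v ∈ V0, φ v ∈ W0) ∧ (∀ v ∈ V1, φ v ∈ W1) ∧ ∀ v, φ (x v) = y (φ v)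

/-- `V` decomposes as a direct sum of `x`-invariant graded subspaces, each isomorphic as a pair
to some `Π^ε M_n` with `P n`. -/
def DecomposesIntoStrings {V : Type*} [AddCommGroup V] [Module k V]
    (V0 V1 : Submodule k V) (x : V →ₗ[k] V) (P : ℕ → Prop) : Prop :=
  ∃ (m : ℕ) (U : Fin m → Submodule k V), DirectSum.IsInternal U ∧
    ∀ i : Fin m, (U i = (U i ⊓ V0) ⊔ (U i ⊓ V1)) ∧
      ∃ (hx : ∀ v ∈ U i, x v ∈ U i) (n ε : ℕ), ε ≤ 1 ∧ P n ∧
        PairIso k (V0.comap (U i).subtype) (V1.comap (U i).subtype) (x.restrict hx)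
          (stringPart k n ε 0) (stringPart k n ε 1) (shiftMap k n)

/-- A pair `(V, x)` (odd nilpotent `x`) is neat if it decomposes into strings `Π^ε M_{2s}`. -/
def IsNeat {V : Type*} [AddCommGroup V] [Module k V]
    (V0 V1 : Submodule k V) (x : V →ₗ[k] V) : Prop :=
  DecomposesIntoStrings k V0 V1 x (fun n => Even n)

end Defs

section Aux
set_option linter.unusedSectionVars false
open Polynomial Module

variable {k : Type*} [Field k] [CharZero k] {V : Type*} [AddCommGroup V] [Module k V]

/-- pointwise osp(1|2) relations -/
structure Trip (x Y h : End k V) : Prop where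
  r1 : ∀ v, h (x v) = x (h v) - (2:k) • x v
  r2 : ∀ v, h (Y v) = Y (h v) + (2:k) • Y v
  r3 : ∀ v, Y (x v) = h v - x (Y v)

theorem Trip.swap {x Y h : End k V} (T : Trip x Y h) : Trip Y (-x) (-h) where
  r1 v := by simp only [LinearMap.neg_apply, map_neg, T.r2]; module
  r2 v := by simp only [LinearMap.neg_apply, map_neg, T.r1]; module
  r3 v := by simp only [LinearMap.neg_apply, map_neg, T.r3]; module

theorem Trip.hpow {x Y h : End k V} (T : Trip x Y h) (j : ℕ) (v : V) :
    h ((x ^ j) v) = (x ^ j) (h v) - (2 * j : k) • (x ^ j) v := by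
  induction j with
  | zero => simp
  | succ j ih =>
    simp only [pow_succ', Module.End.mul_apply, T.r1, ih, map_sub, map_smul]
    push_cast
    module

theorem Trip.string {x Y h : End k V} (T : Trip x Y h) (w : V) (hw : x (Y w) = 0) (m : ℕ) :
    Y ((x ^ (2*m+1)) w) = (x ^ (2*m)) (h w) - (2 * m : k) • (x ^ (2*m)) w ∧
    Y ((x ^ (2*m+2)) w) = -((2 * m + 2 : k) • (x ^ (2*m+1)) w) := by
  have step : ∀ m : ℕ, Y ((x ^ (2*m+1)) w) = (x ^ (2*m)) (h w) - (2 * m : k) • (x ^ (2*m)) w →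
    Y ((x ^ (2*m+2)) w) = -((2 * m + 2 : k) • (x ^ (2*m+1)) w) := by
    intro m h1
    have e : (x ^ (2*m+2)) w = x ((x ^ (2*m+1)) w) := by
      rw [show 2*m+2 = (2*m+1)+1 by ring, pow_succ', Module.End.mul_apply]
    rw [e, T.r3, h1, T.hpow]
    simp only [pow_succ', Module.End.mul_apply, map_sub, map_smul]
    push_cast
    module
  induction m with
  | zero =>
    have : Y ((x ^ (2*0+1)) w) = (x ^ (2*0)) (h w) - (2 * (0:ℕ) : k) • (x ^ (2*0)) w := by
      simp [T.r3, hw]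
    exact ⟨this, step 0 this⟩
  | succ m ih =>
    have : Y ((x ^ (2*(m+1)+1)) w) = (x ^ (2*(m+1))) (h w) - (2 * (m+1 : ℕ) : k) • (x ^ (2*(m+1))) w := by
      have e : (x ^ (2*(m+1)+1)) w = x ((x ^ (2*m+2)) w) := by
        rw [show 2*(m+1)+1 = (2*m+2)+1 by ring, pow_succ', Module.End.mul_apply]
      rw [e, T.r3, ih.2, T.hpow]
      simp only [show 2*(m+1) = (2*m+1)+1 by ring, show 2*m+2 = (2*m+1)+1 by ring,
        pow_succ' x (2*m+1), Module.End.mul_apply, map_neg, map_smul]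
      push_cast
      module
    exact ⟨this, step _ this⟩

/-- product of `X - i` for `i < j` -/
noncomputable def PP (k : Type*) [Field k] (j : ℕ) : k[X] := ∏ i ∈ Finset.range j, (X - C (i:k))
noncomputable def QQ (k : Type*) [Field k] (j : ℕ) : k[X] :=
  ∏ i ∈ Finset.range j, (-X - C 2 - C (i:k))

theorem Trip.ann {x Y h : End k V} (T : Trip x Y h) (j : ℕ) (w : V) (hw : x (Y w) = 0)
    (hj : (x ^ j) w = 0) : aeval h (PP k j) w = 0 := by
  induction j generalizing w with
  | zero => simpa [PP] using hj
  | succ j ih =>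
    rcases Nat.even_or_odd' j with ⟨m, rfl | rfl⟩
    · have h1 := (T.string w hw m).1
      rw [hj, map_zero] at h1
      have h2 := ih (h w - ((2*m : ℕ) : k) • w) (by
          have e : Y (h w) = h (Y w) - (2:k) • Y w := by rw [T.r2]; module
          have e2 : x (h (Y w)) = h (x (Y w)) + (2:k) • x (Y w) := by rw [T.r1]; module
          simp [e, e2, hw]) (by
          rw [map_sub, map_smul, h1]; push_cast; rfl)
      rw [PP, Finset.prod_range_succ, ← PP, map_mul, Module.End.mul_apply]
      have e : aeval h (X - C ((2*m : ℕ) : k)) w = h w - ((2*m : ℕ) : k) • w := by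
        simp only [map_sub, aeval_X, aeval_C, LinearMap.sub_apply, Module.algebraMap_end_apply]
      rw [e]; exact h2
    · have h1 := (T.string w hw m).2
      rw [hj, map_zero, eq_comm, neg_eq_zero, smul_eq_zero] at h1
      have h2 : (x ^ (2*m+1)) w = 0 := by
        rcases h1 with h1 | h1
        · exfalso
          have : ((2*m+2 : ℕ) : k) = 0 := by push_cast; exact h1
          rw [Nat.cast_eq_zero] at this
          omega
        · exact h1
      rw [PP, Finset.prod_range_succ, ← PP, mul_comm, map_mul, Module.End.mul_apply, ih w hw h2, map_zero]

theorem Trip.transp {x Y h : End k V} (T : Trip x Y h) (j : ℕ) (u : V) :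
    x (aeval (-h) (PP k j) u) = aeval h (QQ k j) (x u) := by
  induction j with
  | zero => simp [PP, QQ]
  | succ j ih =>
    rw [PP, QQ, Finset.prod_range_succ, Finset.prod_range_succ, ← PP, ← QQ, mul_comm, mul_comm (QQ k j),
      map_mul, map_mul, Module.End.mul_apply, Module.End.mul_apply, ← ih]
    generalize aeval (-h) (PP k j) u = z
    simp only [map_sub, map_neg, aeval_X, aeval_C, LinearMap.sub_apply, LinearMap.neg_apply,
      Module.algebraMap_end_apply, map_smul, T.r1]
    module

theorem coprimePQ (a b : ℕ) : IsCoprime (PP k a) (QQ k b) := by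
  refine IsCoprime.prod_left fun i _ => IsCoprime.prod_right fun j _ => ?_
  have hne : (-2 - i - j : k) ≠ 0 := by
    intro h0
    have : ((2 + i + j : ℕ) : k) = 0 := by push_cast; linear_combination -h0
    rw [Nat.cast_eq_zero] at this
    omega
  refine ⟨C ((-2 - i - j : k)⁻¹), C ((-2 - i - j : k)⁻¹), ?_⟩
  have : (X - C (i:k)) + (-X - C 2 - C (j:k)) = C (-2 - i - j : k) := by
    simp only [map_sub, map_neg]; ring
  rw [← mul_add, this, ← C_mul, inv_mul_cancel₀ hne, C_1]

theorem Trip.inf_bot {x Y h : End k V} (T : Trip x Y h) (hx : IsNilpotent x) (hY : IsNilpotent Y) :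
    Disjoint (LinearMap.ker Y) (LinearMap.range x) := by
  rw [Submodule.disjoint_def]
  rintro w hw ⟨u, rfl⟩
  rw [LinearMap.mem_ker] at hw
  obtain ⟨N, hN⟩ := hx
  obtain ⟨M, hM⟩ := hY
  have h1 := T.ann N (x u) (by rw [hw, map_zero]) (by rw [hN]; rfl)
  have h2 := T.swap.ann M u (by simp [hw]) (by rw [hM]; rfl)
  have h3 := T.transp M u
  rw [h2, map_zero] at h3
  obtain ⟨a, b, hab⟩ := coprimePQ (k := k) N M
  have := congrArg (fun p => aeval h p (x u)) hab
  simpa [h1, ← h3] using this.symm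

theorem Trip.nilY [FiniteDimensional k V] {x Y h : End k V} (T : Trip x Y h) : IsNilpotent Y := by
  by_contra hn
  have hn' : ∀ n : ℕ, Y ^ n ≠ 0 := fun n h0 => hn ⟨n, h0⟩
  let f : End k (End k V) := LinearMap.mulLeft k h - LinearMap.mulRight k h
  have hev : ∀ n : ℕ, f.HasEigenvalue (2 * n : k) := by
    intro n
    refine Module.End.hasEigenvalue_of_hasEigenvector (x := Y ^ n) ⟨?_, hn' n⟩
    rw [Module.End.mem_eigenspace_iff]
    ext v
    have := T.swap.hpow n v
    simp only [LinearMap.neg_apply, map_neg] at this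
    simp only [f, LinearMap.sub_apply, LinearMap.mulLeft_apply, LinearMap.mulRight_apply,
      Module.End.mul_apply, LinearMap.smul_apply]
    rw [← neg_inj, neg_sub, sub_eq_add_neg, this]
    module
  have hfin : Set.Finite {μ | f.HasEigenvalue μ} := Module.End.finite_hasEigenvalue f
  have hinj : Function.Injective (fun n : ℕ => (2 * n : k)) := by
    intro a b hab
    simpa using hab
  exact Set.infinite_of_injective_forall_mem hinj hev hfin

theorem Trip.sup_top [FiniteDimensional k V] {x Y h : End k V} (T : Trip x Y h) (hx : IsNilpotent x) :
    LinearMap.ker Y ⊔ LinearMap.range x = ⊤ := by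
  have d1 := T.inf_bot hx T.nilY
  have d2 := T.swap.inf_bot T.nilY hx.neg
  have e1 := Submodule.finrank_add_finrank_le_of_disjoint d1
  have e2 := Submodule.finrank_add_finrank_le_of_disjoint d2
  have f1 := LinearMap.finrank_range_add_finrank_ker x
  have f2 := LinearMap.finrank_range_add_finrank_ker Y
  have hk : LinearMap.ker (-x) = LinearMap.ker x := by ext; simp
  rw [hk] at e2
  apply Submodule.eq_top_of_disjoint _ _ _ d1
  omega

/-- an `x`-stable subspace containing `ker Y` is everything -/
theorem Trip.gen [FiniteDimensional k V] {x Y h : End k V} (T : Trip x Y h) (hx : IsNilpotent x)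
    (S : Submodule k V) (hS : LinearMap.ker Y ≤ S) (hxS : ∀ v ∈ S, x v ∈ S) : S = ⊤ := by
  have key : ∀ n : ℕ, ∀ v : V, ∃ s ∈ S, ∃ u, v = s + (x ^ n) u := by
    intro n
    induction n with
    | zero => intro v; exact ⟨0, S.zero_mem, v, by simp⟩
    | succ n ih =>
      intro v
      obtain ⟨s, hs, u, rfl⟩ := ih v
      have hu : u ∈ LinearMap.ker Y ⊔ LinearMap.range x := by rw [T.sup_top hx]; trivial
      obtain ⟨a, ha, b, ⟨c, rfl⟩, rfl⟩ := Submodule.mem_sup.1 hu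
      refine ⟨s + (x ^ n) a, S.add_mem hs ?_, c, ?_⟩
      · have : ∀ m : ℕ, (x ^ m) a ∈ S := by
          intro m
          induction m with
          | zero => exact hS ha
          | succ m ihm => rw [pow_succ', Module.End.mul_apply]; exact hxS _ ihm
        exact this n
      · rw [map_add, pow_succ, Module.End.mul_apply]; abel
  obtain ⟨N, hN⟩ := hx
  rw [eq_top_iff]
  intro v _
  obtain ⟨s, hs, u, rfl⟩ := key N v
  simpa [hN] using hs

theorem kerPP (h : End k V) (j : ℕ) : LinearMap.ker (aeval h (PP k j)) ≤ ⨆ μ, h.eigenspace μ := by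
  induction j with
  | zero => intro v hv; have : v = 0 := by simpa [PP] using hv
            rw [this]; exact Submodule.zero_mem _
  | succ j ih =>
    have hc : IsCoprime (PP k j) (X - C (j:k)) := by
      refine IsCoprime.prod_left fun i hi => ?_
      refine isCoprime_X_sub_C_of_isUnit_sub ?_
      rw [isUnit_iff_ne_zero, sub_ne_zero]
      have := Finset.mem_range.1 hi
      exact_mod_cast this.ne
    rw [PP, Finset.prod_range_succ, ← PP, ← sup_ker_aeval_eq_ker_aeval_mul_of_coprime h hc]
    refine sup_le ih ?_
    refine le_trans ?_ (le_iSup _ (j:k))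
    intro v hv
    rw [Module.End.mem_eigenspace_iff]
    have e : aeval h (X - C (j : k)) v = h v - (j : k) • v := by
      simp only [map_sub, aeval_X, aeval_C, LinearMap.sub_apply, Module.algebraMap_end_apply]
    rw [LinearMap.mem_ker, e, sub_eq_zero] at hv
    exact hv

theorem Trip.diag [FiniteDimensional k V] {x Y h : End k V} (T : Trip x Y h) (hx : IsNilpotent x) :
    ⨆ μ, h.eigenspace μ = ⊤ := by
  apply T.gen hx
  · obtain ⟨N, hN⟩ := hx
    intro w hw
    apply kerPP h N
    rw [LinearMap.mem_ker] at hw ⊢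
    exact T.ann N w (by rw [hw, map_zero]) (by rw [hN]; rfl)
  · intro v hv
    induction hv using Submodule.iSup_induction' with
    | mem μ v hv =>
      refine (le_iSup (fun μ => h.eigenspace μ) (μ - 2)) ?_
      rw [Module.End.mem_eigenspace_iff] at hv ⊢
      rw [T.r1, hv, map_smul]; module
    | zero => rw [map_zero]; exact Submodule.zero_mem _
    | add a b _ _ ha hb => rw [map_add]; exact Submodule.add_mem _ ha hb

theorem Trip.th1 {x Y h : End k V} (T : Trip x Y h) (z : V) :
    h (x z) - (2:k) • x (Y (x z)) + x z = - x (h z - (2:k) • x (Y z) + z) := by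
  simp only [T.r3, T.r1, map_sub, map_add, map_smul]
  module

theorem Trip.thpow {x Y h : End k V} (T : Trip x Y h) (j : ℕ) (z : V) :
    h ((x ^ j) z) - (2:k) • x (Y ((x ^ j) z)) + (x ^ j) z
      = (-1 : k) ^ j • (x ^ j) (h z - (2:k) • x (Y z) + z) := by
  induction j with
  | zero => simp
  | succ j ih =>
    rw [pow_succ' x, Module.End.mul_apply, T.th1, ih, Module.End.mul_apply, map_smul, pow_succ']
    module

/-- `ker x ∩ im x^j` -/
def KK (x : End k V) (j : ℕ) : Submodule k V := LinearMap.ker x ⊓ LinearMap.range (x ^ j)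

theorem KK_succ (x : End k V) (j : ℕ) : KK x (j+1) ≤ KK x j := by
  rintro v ⟨h1, ⟨u, rfl⟩⟩
  refine ⟨h1, ⟨x u, ?_⟩⟩
  rw [pow_succ, Module.End.mul_apply]

theorem Trip.KKh {x Y h : End k V} (T : Trip x Y h) (j : ℕ) (v : V) (hv : v ∈ KK x j) :
    h v + (j:k) • v ∈ KK x (j+1) := by
  obtain ⟨h1, ⟨u, hu⟩⟩ := hv
  replace h1 : x v = 0 := h1
  constructor
  · have : x (h v) = h (x v) + (2:k) • x v := by rw [T.r1]; module
    simp [this, h1]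
  · have e1 := T.thpow j u
    have e2 := T.hpow j u
    have e3 := T.r3 v
    rw [h1, map_zero, eq_comm, sub_eq_zero] at e3
    rw [hu] at e2
    simp only [map_add, map_sub, map_smul, hu] at e1
    rw [← e3] at e1
    have e4 : (x ^ j) (x (Y u)) = (x ^ (j+1)) (Y u) := by rw [pow_succ, Module.End.mul_apply]
    have e5 : (x ^ j) (h u) = h v + (2 * j : k) • v := by rw [e2]; module
    rw [e4, e5] at e1
    rcases Nat.even_or_odd j with hj | hj
    · rw [hj.neg_one_pow] at e1
      refine ⟨Y u, ?_⟩
      have : (2:k) • ((x ^ (j+1)) (Y u)) = (2:k) • (h v + (j:k) • v) := by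
        linear_combination (norm := module) (1:k) • e1
      exact smul_right_injective V (two_ne_zero (α := k)) this
    · rw [hj.neg_one_pow] at e1
      have hne : ((j+1 : ℕ) : k) ≠ 0 := by rw [Nat.cast_ne_zero]; omega
      have e6 : (2:k) • ((x ^ (j+1)) (Y u)) = (2:k) • (((j+1 : ℕ) : k) • v) := by
        push_cast
        linear_combination (norm := module) (-1:k) • e1
      have e7 := smul_right_injective V (two_ne_zero (α := k)) e6
      have e8 : v = (x ^ (j+1)) ((((j+1 : ℕ) : k)⁻¹) • Y u) := by
        rw [map_smul, e7, smul_smul, inv_mul_cancel₀ hne, one_smul]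
      have e9 : h v ∈ LinearMap.range (x ^ (j+1)) := by
        rw [e8, T.hpow]
        exact Submodule.sub_mem _ ⟨_, rfl⟩ (Submodule.smul_mem _ _ ⟨_, rfl⟩)
      exact Submodule.add_mem _ e9 (Submodule.smul_mem _ _ ⟨_, e8.symm⟩)

theorem Trip.KKstable {x Y h : End k V} (T : Trip x Y h) (j : ℕ) (v : V) (hv : v ∈ KK x j) :
    h v ∈ KK x j := by
  have := Submodule.sub_mem _ (KK_succ x j (T.KKh j v hv)) (Submodule.smul_mem _ (j:k) hv)
  simpa using this

theorem aeval_stable (h : End k V) (W : Submodule k V) (hW : ∀ v ∈ W, h v ∈ W) (q : k[X])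
    (v : V) (hv : v ∈ W) : aeval h q v ∈ W := by
  induction q using Polynomial.induction_on' with
  | add p q hp hq => rw [map_add]; exact W.add_mem hp hq
  | monomial n a =>
    rw [aeval_monomial, Module.End.mul_apply, Module.algebraMap_end_apply]
    refine W.smul_mem _ ?_
    induction n with
    | zero => simpa using hv
    | succ n ih => rw [pow_succ', Module.End.mul_apply]; exact hW _ ih

theorem Trip.KKpoly {x Y h : End k V} (T : Trip x Y h) (j : ℕ) (v : V) (hv : v ∈ KK x j)
    (q : k[X]) : aeval h q v - q.eval (-j : k) • v ∈ KK x (j+1) := by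
  obtain ⟨r, hr⟩ : (X - C (-j : k)) ∣ q - C (q.eval (-j:k)) := X_sub_C_dvd_sub_C_eval
  have := congrArg (fun p => aeval h p v) hr
  simp only [map_sub, map_mul, LinearMap.sub_apply, aeval_C, Module.algebraMap_end_apply] at this
  have hcomm : (aeval h (X : k[X]) - algebraMap k (End k V) (-j)) * aeval h r
      = aeval h r * (aeval h (X : k[X]) - algebraMap k (End k V) (-j)) := by
    have : (X - C (-j : k)) * r = r *  (X - C (-j : k)) := mul_comm _ _
    simpa only [map_mul, map_sub, aeval_C] using congrArg (aeval h) this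
  rw [this, hcomm, Module.End.mul_apply]
  refine aeval_stable h _ (T.KKstable (j+1)) r _ ?_
  have e := T.KKh j v hv
  simp only [aeval_X, LinearMap.sub_apply, Module.algebraMap_end_apply, neg_smul, sub_neg_eq_add]
  exact e

theorem Trip.find_K {x Y h : End k V} (T : Trip x Y h) (hx : IsNilpotent x) (i : ℕ) (z : V) (μ : k)
    (hz : z ∈ KK x i) (hz0 : z ≠ 0) (hμ : h z = μ • z) : ∃ j : ℕ, i ≤ j ∧ μ = -j := by
  by_contra hcon
  push Not at hcon
  have : ∀ n : ℕ, z ∈ KK x (i+n) := by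
    intro n
    induction n with
    | zero => exact hz
    | succ n ih =>
      have e := T.KKh _ _ ih
      rw [hμ, ← add_smul] at e
      refine (Submodule.smul_mem_iff _ ?_).1 e
      intro h0
      exact hcon (i+n) (by omega) (eq_neg_of_add_eq_zero_left h0)
  obtain ⟨N, hN⟩ := hx
  obtain ⟨_, u, hu⟩ := this N
  rw [pow_add, hN] at hu
  exact hz0 (by simpa using hu.symm)

theorem exists_len {x : End k V} (v : V) (hv : v ≠ 0) (a : ℕ) (ha : (x ^ a) v = 0) :
    ∃ i, i + 1 ≤ a ∧ (x ^ i) v ≠ 0 ∧ (x ^ (i+1)) v = 0 := by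
  classical
  have hex : ∃ a, (x ^ a) v = 0 := ⟨a, ha⟩
  obtain ⟨i, hi⟩ : ∃ i, Nat.find hex = i + 1 := by
    refine Nat.exists_eq_succ_of_ne_zero ?_
    intro h0
    have := Nat.find_spec hex
    rw [h0] at this
    exact hv (by simpa using this)
  refine ⟨i, ?_, ?_, ?_⟩
  · rw [← hi]; exact Nat.find_min' hex ha
  · exact Nat.find_min hex (by omega)
  · rw [← hi]; exact Nat.find_spec hex

theorem Trip.L1 {x Y h : End k V} (T : Trip x Y h) (hx : IsNilpotent x) (v : V) (hv : v ≠ 0)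
    (μ : k) (hμ : h v = μ • v) (a : ℕ) (ha : (x ^ a) v = 0) :
    ∃ m : ℤ, μ = m ∧ m + 1 ≤ a := by
  obtain ⟨i, hi, h1, h2⟩ := exists_len v hv a ha
  obtain ⟨j, hj, e⟩ := T.find_K hx i ((x ^ i) v) (μ - 2 * i)
    ⟨by change x _ = 0; rw [← Module.End.mul_apply, ← pow_succ', h2], ⟨v, rfl⟩⟩ h1
    (by rw [T.hpow, hμ, map_smul]; module)
  refine ⟨2 * i - j, ?_, by omega⟩
  push_cast
  linear_combination e

theorem Trip.L2 {x Y h : End k V} (T : Trip x Y h) (w : V) (hYw : Y w = 0)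
    (μ : k) (hμ : h w = μ • w) (i : ℕ) (h1 : (x ^ i) w ≠ 0) (h2 : (x ^ (i+1)) w = 0) :
    μ = i := by
  rcases Nat.even_or_odd' i with ⟨m, rfl | rfl⟩
  · have e := (T.string w (by rw [hYw, map_zero]) m).1
    rw [h2, hμ, map_zero, map_smul, ← sub_smul, eq_comm, smul_eq_zero] at e
    push_cast
    exact sub_eq_zero.1 (e.resolve_right h1)
  · have e := (T.string w (by rw [hYw, map_zero]) m).2
    rw [h2, map_zero, eq_comm, neg_eq_zero, smul_eq_zero] at e
    have : ((2*m+2 : ℕ) : k) = 0 := by push_cast; exact e.resolve_right h1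
    rw [Nat.cast_eq_zero] at this
    omega

theorem ext_eig {h : End k V} (ht : ⨆ μ, h.eigenspace μ = ⊤) (f g : End k V)
    (hfg : ∀ (μ : k) (v : V), h v = μ • v → f v = g v) : f = g := by
  have : ⨆ μ, h.eigenspace μ ≤ LinearMap.eqLocus f g :=
    iSup_le fun μ v hv => hfg μ v (Module.End.mem_eigenspace_iff.1 hv)
  rw [ht] at this
  ext v
  exact this trivial

theorem Trip.conj [FiniteDimensional k V] {x Y h Y' h' : End k V} (T : Trip x Y h)
    (T' : Trip x Y' h') (hx : IsNilpotent x) :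
    ∃ g : End k V, Function.Injective g ∧ (∀ v, g (x v) = x (g v)) ∧ (∀ v, g (h v) = h' (g v)) ∧
      (∀ v, g (Y v) = Y' (g v)) ∧
      ∀ W : Submodule k V, (∀ v ∈ W, h v ∈ W) → (∀ v ∈ W, h' v ∈ W) → ∀ v ∈ W, g v ∈ W := by
  classical
  have ht := T.diag hx
  have ht' := T'.diag hx
  obtain ⟨N, hN⟩ := id hx
  let s : Finset k := (h.finite_hasEigenvalue.toFinset ∪ h'.finite_hasEigenvalue.toFinset) ∪
    (Finset.range N).image (fun j : ℕ => (-j : k))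
  have hs : ∀ μ v, v ≠ 0 → h v = μ • v → μ ∈ s := by
    intro μ v hv e
    have : h.HasEigenvalue μ := Module.End.hasEigenvalue_of_hasEigenvector
      ⟨Module.End.mem_eigenspace_iff.2 e, hv⟩
    simp [s, this]
  have hs' : ∀ μ v, v ≠ 0 → h' v = μ • v → μ ∈ s := by
    intro μ v hv e
    have : h'.HasEigenvalue μ := Module.End.hasEigenvalue_of_hasEigenvector
      ⟨Module.End.mem_eigenspace_iff.2 e, hv⟩
    simp [s, this]
  have hsN : ∀ j : ℕ, j < N → (-j : k) ∈ s := by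
    intro j hj
    apply Finset.mem_union_right
    exact Finset.mem_image.2 ⟨j, Finset.mem_range.2 hj, rfl⟩
  let q : k → k[X] := fun μ => if μ ∈ s then Lagrange.basis s id μ else 0
  have hq : ∀ μ, ∀ ν ∈ s, (q μ).eval ν = if μ = ν then 1 else 0 := by
    intro μ ν hν
    by_cases hμ : μ ∈ s
    · simp only [q, if_pos hμ]
      split_ifs with e
      · subst e; exact Lagrange.eval_basis_self (v := id) Function.injective_id.injOn hμ
      · exact Lagrange.eval_basis_of_ne (v := id) e hν
    · have : μ ≠ ν := fun e => hμ (e ▸ hν)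
      simp [q, hμ, this]
  have hp : ∀ μ ν v, h v = ν • v → aeval h (q μ) v = if μ = ν then v else 0 := by
    intro μ ν v e
    rcases eq_or_ne v 0 with rfl | hv
    · simp
    rw [Module.End.aeval_apply_of_mem_apply_eq_smul e, hq μ ν (hs _ _ hv e)]
    split_ifs <;> simp
  have hp' : ∀ μ ν v, h' v = ν • v → aeval h' (q μ) v = if μ = ν then v else 0 := by
    intro μ ν v e
    rcases eq_or_ne v 0 with rfl | hv
    · simp
    rw [Module.End.aeval_apply_of_mem_apply_eq_smul e, hq μ ν (hs' _ _ hv e)]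
    split_ifs <;> simp
  let g : End k V := ∑ μ ∈ s, aeval h' (q μ) * aeval h (q μ)
  have hgv : ∀ v, g v = ∑ μ ∈ s, aeval h' (q μ) (aeval h (q μ) v) := by
    intro v; simp [g, LinearMap.sum_apply]
  have hg : ∀ μ v, h v = μ • v → g v = aeval h' (q μ) v := by
    intro μ v e
    rcases eq_or_ne v 0 with rfl | hv
    · simp
    rw [hgv, Finset.sum_eq_single μ]
    · rw [hp μ μ v e, if_pos rfl]
    · intro ν _ hne
      rw [hp ν μ v e, if_neg hne, map_zero]
    · intro hn; exact absurd (hs _ _ hv e) hn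
  have hgW : ∀ W : Submodule k V, (∀ v ∈ W, h v ∈ W) → (∀ v ∈ W, h' v ∈ W) → ∀ v ∈ W, g v ∈ W := by
    intro W h1 h2 v hv
    rw [hgv]
    exact W.sum_mem fun μ _ => aeval_stable h' W h2 _ _ (aeval_stable h W h1 _ _ hv)
  have hpx : ∀ μ, aeval h' (q (μ - 2)) * x = x * aeval h' (q μ) := by
    intro μ
    refine ext_eig ht' _ _ fun ν v e => ?_
    have e2 : h' (x v) = (ν - 2) • x v := by rw [T'.r1, e, map_smul]; module
    rw [Module.End.mul_apply, Module.End.mul_apply, hp' _ _ _ e2, hp' _ _ _ e]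
    by_cases hμ : μ = ν <;> simp [hμ]
  have hph : ∀ μ, h' * aeval h' (q μ) = μ • aeval h' (q μ) := by
    intro μ
    refine ext_eig ht' _ _ fun ν v e => ?_
    rw [Module.End.mul_apply, LinearMap.smul_apply, hp' _ _ _ e]
    split_ifs with hμ
    · rw [e, hμ]
    · simp
  have hgx : g * x = x * g := by
    refine ext_eig ht _ _ fun μ v e => ?_
    have e2 : h (x v) = (μ - 2) • x v := by rw [T.r1, e, map_smul]; module
    rw [Module.End.mul_apply, Module.End.mul_apply, hg _ _ e2, hg _ _ e]
    exact congrArg (fun f : End k V => f v) (hpx μ)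
  have hgh : g * h = h' * g := by
    refine ext_eig ht _ _ fun μ v e => ?_
    rw [Module.End.mul_apply, Module.End.mul_apply, hg _ _ e, e, map_smul, hg _ _ e]
    exact (congrArg (fun f : End k V => f v) (hph μ)).symm
  have hgx' : ∀ v, g (x v) = x (g v) := fun v => congrArg (fun f : End k V => f v) hgx
  have hgh' : ∀ v, g (h v) = h' (g v) := fun v => congrArg (fun f : End k V => f v) hgh
  have hker : ∀ v, x v = 0 → g v = 0 → v = 0 := by
    intro v hxv hgv0
    have step : ∀ j, j ≤ N → v ∈ KK x j := by
      intro j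
      induction j with
      | zero => intro _; exact ⟨hxv, ⟨v, by simp⟩⟩
      | succ j ih =>
        intro hj
        have hv := ih (by omega)
        have hsj := hsN j (by omega)
        have key : ∀ μ, aeval h' (q μ) (aeval h (q μ) v)
            - (((q μ).eval (-j:k)) * ((q μ).eval (-j:k))) • v ∈ KK x (j+1) := by
          intro μ
          have a1 := T'.KKpoly j _ (aeval_stable h _ (T.KKstable j) (q μ) v hv) (q μ)
          have a2 := Submodule.smul_mem _ ((q μ).eval (-j:k)) (T.KKpoly j v hv (q μ))
          have := Submodule.add_mem _ a1 a2
          rw [smul_sub, smul_smul, sub_add_sub_cancel] at this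
          exact this
        have hsum := Submodule.sum_mem (KK x (j+1)) (t := s) (fun μ _ => key μ)
        rw [Finset.sum_sub_distrib, ← hgv, hgv0, ← Finset.sum_smul, Finset.sum_eq_single (-j:k)] at hsum
        · rw [hq _ _ hsj, if_pos rfl] at hsum
          simpa using hsum
        · intro ν _ hne
          rw [hq _ _ hsj, if_neg hne, mul_zero]
        · intro hn; exact absurd hsj hn
    obtain ⟨_, u, hu⟩ := step N le_rfl
    rw [hN] at hu
    simpa using hu.symm
  have hginj : Function.Injective g := by
    rw [injective_iff_map_eq_zero]
    intro v hv
    by_contra hv0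
    obtain ⟨i, _, h1, h2⟩ := exists_len (x := x) v hv0 N (by rw [hN]; rfl)
    refine h1 (hker _ (by rw [← Module.End.mul_apply, ← pow_succ', h2]) ?_)
    have : ∀ n : ℕ, g ((x ^ n) v) = 0 := by
      intro n
      induction n with
      | zero => simpa using hv
      | succ n ih => rw [pow_succ', Module.End.mul_apply, hgx', ih, map_zero]
    exact this i
  refine ⟨g, hginj, hgx', hgh', ?_, hgW⟩
  let D : End k V := Y' * g - g * Y
  have hDv : ∀ v, D v = Y' (g v) - g (Y v) := fun v => rfl
  have hDx : ∀ v, x (D v) = - D (x v) := by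
    intro v
    rw [hDv, hDv, hgx', T'.r3, T.r3, map_sub, map_sub, hgx', hgh']
    module
  have hDh : ∀ v, h' (D v) = D (h v) + (2:k) • D v := by
    intro v
    have : Y (h v) = h (Y v) - (2:k) • Y v := by rw [T.r2]; module
    rw [hDv, hDv, hgh', this, map_sub, map_sub, T'.r2, hgh', map_smul]
    module
  have hDpow : ∀ (n : ℕ) v, (x ^ n) v = 0 → (x ^ n) (D v) = 0 := by
    intro n v hv
    have : ∀ n : ℕ, (x ^ n) (D v) = (-1:k) ^ n • D ((x ^ n) v) := by
      intro n
      induction n with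
      | zero => simp
      | succ n ih =>
        rw [pow_succ' x, Module.End.mul_apply, ih, map_smul, hDx, Module.End.mul_apply, pow_succ]
        module
    rw [this, hv, map_zero, smul_zero]
  have hDw : ∀ (μ : k) (w : V), Y w = 0 → h w = μ • w → D w = 0 := by
    intro μ w hYw hμ
    by_contra hne
    have hw0 : w ≠ 0 := fun e => hne (by rw [e, map_zero])
    obtain ⟨i, _, h1, h2⟩ := exists_len (x := x) w hw0 N (by rw [hN]; rfl)
    have hi := T.L2 w hYw μ hμ i h1 h2
    obtain ⟨m, hm, hle⟩ := T'.L1 hx (D w) hne (μ + 2)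
      (by rw [hDh, hμ, map_smul]; module) (i+1) (hDpow _ _ h2)
    rw [hi] at hm
    have : ((i + 2 : ℤ) : k) = (m : k) := by push_cast; exact hm
    have := Int.cast_injective this
    push_cast at hle
    omega
  have hone : ∑ μ ∈ s, aeval h (q μ) = 1 := by
    refine ext_eig ht _ _ fun μ v e => ?_
    rcases eq_or_ne v 0 with rfl | hv
    · simp
    rw [LinearMap.sum_apply, Finset.sum_eq_single μ]
    · rw [hp μ μ v e, if_pos rfl]; rfl
    · intro ν _ hne
      rw [hp ν μ v e, if_neg hne]
    · intro hn; exact absurd (hs _ _ hv e) hn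
  have hph2 : ∀ μ, h * aeval h (q μ) = μ • aeval h (q μ) := by
    intro μ
    refine ext_eig ht _ _ fun ν v e => ?_
    rw [Module.End.mul_apply, LinearMap.smul_apply, hp _ _ _ e]
    split_ifs with hμ
    · rw [e, hμ]
    · simp
  have htop : LinearMap.ker D = ⊤ := by
    apply T.gen hx
    · intro w hw
      have e : w = ∑ μ ∈ s, aeval h (q μ) w := by
        rw [← LinearMap.sum_apply, hone]; rfl
      rw [e]
      refine Submodule.sum_mem _ fun μ _ => ?_
      refine hDw μ _ ?_ (congrArg (fun f : End k V => f w) (hph2 μ))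
      refine aeval_stable h (LinearMap.ker Y) ?_ (q μ) w hw
      intro v hv
      rw [LinearMap.mem_ker] at hv ⊢
      have : Y (h v) = h (Y v) - (2:k) • Y v := by rw [T.r2]; module
      rw [this, hv]; simp
    · intro v hv
      rw [LinearMap.mem_ker] at hv ⊢
      rw [← neg_eq_zero, ← hDx, hv, map_zero]
  intro v
  have : v ∈ LinearMap.ker D := by rw [htop]; trivial
  rw [LinearMap.mem_ker, hDv, sub_eq_zero] at this
  exact this.symm

end Aux

/-- **Uniqueness up to conjugation in the super Jacobson–Morozov lemma** (instance `G = GL(V)`):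
two `osp(1|2)`-triples `(h, x, Y)`, `(h', x, Y')` extending the same neat odd nilpotent `x` are
conjugate by an even invertible endomorphism `g` fixing `x`. -/
theorem super_jacobson_morozov_unique {k : Type*} [Field k] [CharZero k]
    (V : Type*) [AddCommGroup V] [Module k V] [FiniteDimensional k V]
    (V0 V1 : Submodule k V) (hcompl : IsCompl V0 V1)
    (x : V →ₗ[k] V) (hodd : IsOddMap k V0 V1 x) (hnil : IsNilpotent x)
    (hneat : IsNeat k V0 V1 x)
    (h Y h' Y' : V →ₗ[k] V)
    (hheven : IsEvenMap k V0 V1 h) (hYodd : IsOddMap k V0 V1 Y)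
    (hh'even : IsEvenMap k V0 V1 h') (hY'odd : IsOddMap k V0 V1 Y')
    (rel1 : h ∘ₗ x - x ∘ₗ h = -((2 : k) • x))
    (rel2 : h ∘ₗ Y - Y ∘ₗ h = (2 : k) • Y)
    (rel3 : Y ∘ₗ x + x ∘ₗ Y = h)
    (rel1' : h' ∘ₗ x - x ∘ₗ h' = -((2 : k) • x))
    (rel2' : h' ∘ₗ Y' - Y' ∘ₗ h' = (2 : k) • Y')
    (rel3' : Y' ∘ₗ x + x ∘ₗ Y' = h') :
    ∃ g : V ≃ₗ[k] V, IsEvenMap k V0 V1 (g : V →ₗ[k] V) ∧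
      (g : V →ₗ[k] V) ∘ₗ x ∘ₗ (g.symm : V →ₗ[k] V) = x ∧
      (g : V →ₗ[k] V) ∘ₗ h ∘ₗ (g.symm : V →ₗ[k] V) = h' ∧
      (g : V →ₗ[k] V) ∘ₗ Y ∘ₗ (g.symm : V →ₗ[k] V) = Y' := by
  have T : Trip x Y h := by
    refine ⟨fun v => ?_, fun v => ?_, fun v => ?_⟩
    · have e := LinearMap.congr_fun rel1 v
      simp only [LinearMap.sub_apply, LinearMap.comp_apply, LinearMap.neg_apply,
        LinearMap.smul_apply] at e
      rw [sub_eq_iff_eq_add] at e; rw [e]; abel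
    · have e := LinearMap.congr_fun rel2 v
      simp only [LinearMap.sub_apply, LinearMap.comp_apply, LinearMap.smul_apply] at e
      rw [sub_eq_iff_eq_add] at e; rw [e]; abel
    · exact eq_sub_of_add_eq (LinearMap.congr_fun rel3 v)
  have T' : Trip x Y' h' := by
    refine ⟨fun v => ?_, fun v => ?_, fun v => ?_⟩
    · have e := LinearMap.congr_fun rel1' v
      simp only [LinearMap.sub_apply, LinearMap.comp_apply, LinearMap.neg_apply,
        LinearMap.smul_apply] at e
      rw [sub_eq_iff_eq_add] at e; rw [e]; abel
    · have e := LinearMap.congr_fun rel2' v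
      simp only [LinearMap.sub_apply, LinearMap.comp_apply, LinearMap.smul_apply] at e
      rw [sub_eq_iff_eq_add] at e; rw [e]; abel
    · exact eq_sub_of_add_eq (LinearMap.congr_fun rel3' v)
  obtain ⟨g, hinj, hgx, hgh, hgY, hW⟩ := T.conj T' hnil
  let e := LinearEquiv.ofInjectiveEndo g hinj
  have he : ∀ v, e v = g v := fun v => rfl
  refine ⟨e, ⟨hW V0 hheven.1 hh'even.1, hW V1 hheven.2 hh'even.2⟩, ?_, ?_, ?_⟩
  · ext v
    simp only [LinearMap.comp_apply, LinearEquiv.coe_coe]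
    rw [he, hgx, ← he, LinearEquiv.apply_symm_apply]
  · ext v
    simp only [LinearMap.comp_apply, LinearEquiv.coe_coe]
    rw [he, hgh, ← he, LinearEquiv.apply_symm_apply]
  · ext v
    simp only [LinearMap.comp_apply, LinearEquiv.coe_coe]
    rw [he, hgY, ← he, LinearEquiv.apply_symm_apply]
end

section
/- Let k be a field of characteristic zero and let k, m ≥ 0 be integers. There is an isomorphism of pairs M_{2k+1} ⊗ M_{2m} ≅ ⊕_{s=min(|k−m|,|k−m+1|)}^{k+m} Π^{(k+m−s) mod 2} M_{2s+1}, i.e. an even linear isomorphism intertwining the odd endomorphism on the tensor product with the direct sum of the string endomorphisms. [Clebsch–Gordan decomposition for the supergroup 𝔾_a^{(1|1)}, odd ⊗ even case.] -/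
open scoped TensorProduct

section Defs

variable (k : Type*) [Field k]

variable {V W : Type*} [AddCommGroup V] [Module k V] [AddCommGroup W] [Module k W]

/-- The set of pure tensors `v ⊗ w` with `v ∈ A`, `w ∈ B`. -/
def pureTensors (A : Submodule k V) (B : Submodule k W) : Set (V ⊗[k] W) :=
  {t | ∃ v ∈ A, ∃ w ∈ B, t = v ⊗ₜ[k] w}

/-- The even part `(V₀⊗W₀) ⊕ (V₁⊗W₁)` of the tensor product of two superspaces. -/
def tensorEven (V0 V1 : Submodule k V) (W0 W1 : Submodule k W) : Submodule k (V ⊗[k] W) :=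
  Submodule.span k (pureTensors k V0 W0 ∪ pureTensors k V1 W1)

/-- The odd part `(V₀⊗W₁) ⊕ (V₁⊗W₀)` of the tensor product of two superspaces. -/
def tensorOdd (V0 V1 : Submodule k V) (W0 W1 : Submodule k W) : Submodule k (V ⊗[k] W) :=
  Submodule.span k (pureTensors k V0 W1 ∪ pureTensors k V1 W0)

/-- `z` is the super tensor-product endomorphism induced by `x` and `y`:
`z (v ⊗ w) = x v ⊗ w + (-1)^p v ⊗ y w` for `v` homogeneous of parity `p`. -/
def IsSuperTensorMap (V0 V1 : Submodule k V) (x : V →ₗ[k] V) (y : W →ₗ[k] W)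
    (z : V ⊗[k] W →ₗ[k] V ⊗[k] W) : Prop :=
  (∀ v ∈ V0, ∀ w : W, z (v ⊗ₜ[k] w) = (x v) ⊗ₜ[k] w + v ⊗ₜ[k] (y w)) ∧
  (∀ v ∈ V1, ∀ w : W, z (v ⊗ₜ[k] w) = (x v) ⊗ₜ[k] w - v ⊗ₜ[k] (y w))

/-- Componentwise shift endomorphism on a finite direct sum of string modules. -/
def multiShift {N : ℕ} (n : Fin N → ℕ) :
    ((i : Fin N) → (Fin (n i + 1) → k)) →ₗ[k] ((i : Fin N) → (Fin (n i + 1) → k)) :=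
  LinearMap.pi (fun i => (shiftMap k (n i)).comp (LinearMap.proj i))

/-- Even/odd part of a finite direct sum of string modules `⊕ᵢ Π^{ε i} M_{n i}`. -/
def multiPart {N : ℕ} (n ε : Fin N → ℕ) (r : ℕ) :
    Submodule k ((i : Fin N) → (Fin (n i + 1) → k)) :=
  Submodule.pi Set.univ (fun i => stringPart k (n i) (ε i) r)

end Defs

section CG

variable {k : Type*} [Field k]

theorem cg_lef [CharZero k] {V : Type*} [AddCommGroup V] [Module k V]
    (S : ℕ → Submodule k V) (L F : V →ₗ[k] V) (M : ℕ)
    (hF : ∀ d, ∀ v ∈ S (d+2), F v ∈ S d) (hF0 : ∀ d, d < 2 → ∀ v ∈ S d, F v = 0)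
    (hL : ∀ d, ∀ v ∈ S d, L v ∈ S (d+2))
    (hc : ∀ d, ∀ v ∈ S d, F (L v) - L (F v) = ((M:k) - d) • v) :
    ∀ d r, r + d ≤ M → ∀ v ∈ S d, (L^r) v = 0 → v = 0 := by
  have hLr : ∀ r d, ∀ v ∈ S d, (L^r) v ∈ S (d+2*r) := by
    intro r
    induction r with
    | zero => intro d v hv; simpa using hv
    | succ r ih =>
      intro d v hv
      rw [pow_succ']
      have := hL _ _ (ih d v hv)
      exact this
  have hcr : ∀ r d : ℕ, ∀ v ∈ S d, F ((L^(r+1)) v) - (L^(r+1)) (F v)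
      = (((r:k)+1) * (M - d - r)) • (L^r) v := by
    intro r
    induction r with
    | zero => intro d v hv; simpa using hc d v hv
    | succ r ih =>
      intro d v hv
      have h1 := ih d v hv
      have h2 := hc _ _ (hLr (r+1) d v hv)
      have e1 : (L^(r+1+1)) v = L ((L^(r+1)) v) := by rw [pow_succ']; rfl
      have e2 : (L^(r+1+1)) (F v) = L ((L^(r+1)) (F v)) := by rw [pow_succ']; rfl
      have e3 : (L^(r+1)) v = L ((L^r) v) := by rw [pow_succ']; rfl
      have h3 := congrArg L h1
      rw [map_sub, map_smul, ← e3] at h3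
      rw [e1, e2]
      have : F (L ((L^(r+1)) v)) - L ((L^(r+1)) (F v)) =
        (F (L ((L^(r+1)) v)) - L (F ((L^(r+1)) v))) +
        (L (F ((L^(r+1)) v)) - L ((L^(r+1)) (F v))) := by abel
      rw [this, h2, h3, ← add_smul]
      congr 1
      push_cast
      ring
  intro d
  induction d using Nat.strong_induction_on with
  | _ d ihd =>
    intro r
    induction r with
    | zero => intro _ v _ h; simpa using h
    | succ r ih =>
      intro hr v hv h
      have hFv : F v = 0 := by
        by_cases hd : d < 2
        · exact hF0 d hd v hv
        · obtain ⟨d, rfl⟩ : ∃ d', d = d' + 2 := ⟨d-2, by omega⟩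
          refine ihd d (by omega) (r+1+1) (by omega) (F v) (hF d v hv) ?_
          have h1 := hcr r _ v hv
          have h2 := hcr (r+1) _ v hv
          have e1 : (L^(r+1+1)) v = L ((L^(r+1)) v) := by rw [pow_succ']; rfl
          rw [e1, h] at h2
          simpa using h2
      have h1 := hcr r _ v hv
      rw [h, hFv] at h1
      simp only [map_zero, sub_zero] at h1
      have h2 : (((r:k)+1) * (M - d - r)) ≠ 0 := by
        obtain ⟨t, rfl⟩ : ∃ t, M = r + 1 + d + t := ⟨M - (r+1+d), by omega⟩
        have : (((r:k)+1) * (((r + 1 + d + t : ℕ):k) - d - r)) = (((r+1)*(t+1) : ℕ) : k) := by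
          push_cast; ring
        rw [this]
        exact Nat.cast_ne_zero.mpr (by positivity)
      refine ih (by omega) v hv ?_
      exact (smul_eq_zero.mp h1.symm).resolve_left h2

/-- basis vector (zero if out of range) -/
def cgE1 (k : Type*) [Field k] (n i : ℕ) : Fin (n+1) → k := fun j => if (j:ℕ) = i then 1 else 0

def cgE (k : Type*) [Field k] (n m i j : ℕ) : (Fin (n+1) → k) ⊗[k] (Fin (m+1) → k) :=
  cgE1 k n i ⊗ₜ cgE1 k m j

theorem cgE1_zero {n i : ℕ} (h : n < i) : cgE1 k n i = 0 := by
  funext j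
  have := j.2
  simp [cgE1]; omega

theorem cgE_zero1 {n m i j : ℕ} (h : n < i) : cgE k n m i j = 0 := by
  simp [cgE, cgE1_zero h]

theorem cgE_zero2 {n m i j : ℕ} (h : m < j) : cgE k n m i j = 0 := by
  simp [cgE, cgE1_zero h]

theorem shift_E1 (n i : ℕ) : shiftMap k n (cgE1 k n i) = cgE1 k n (i+1) := by
  funext j
  simp only [shiftMap, cgE1, LinearMap.coe_mk, AddHom.coe_mk]
  split_ifs <;> first | rfl | omega

/-- weighted downward shift -/
def cgDown (n s : ℕ) (c : ℕ → k) : (Fin (n+1) → k) →ₗ[k] (Fin (n+1) → k) where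
  toFun f := fun j => if h : (j:ℕ) + s < n + 1 then c (j+s) * f ⟨j+s, h⟩ else 0
  map_add' f g := by funext j; simp only [Pi.add_apply]; split_ifs <;> simp [mul_add]
  map_smul' c f := by
    funext j; simp only [Pi.smul_apply, RingHom.id_apply]; split_ifs <;> simp [mul_left_comm]

theorem down_E1 (n s : ℕ) (c : ℕ → k) (i : ℕ) (hi : i ≤ n) (hc : i < s → c i = 0) :
    cgDown n s c (cgE1 k n i) = c i • cgE1 k n (i - s) := by
  funext j
  simp only [cgDown, cgE1, LinearMap.coe_mk, AddHom.coe_mk, Pi.smul_apply, smul_eq_mul]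
  by_cases h : i < s
  · rw [hc h]
    split_ifs <;> first | omega | simp
  · by_cases h2 : (j:ℕ) + s = i
    · have : (j:ℕ) = i - s := by omega
      rw [dif_pos (by omega), if_pos h2, if_pos this, h2]
    · have : ¬ (j:ℕ) = i - s := by omega
      simp [h2, this]

def cgSgn (k : Type*) [Field k] (n e : ℕ) : (Fin (n+1) → k) →ₗ[k] (Fin (n+1) → k) where
  toFun f := fun j => (-1)^((j:ℕ)+e) * f j
  map_add' f g := by funext j; simp [mul_add]
  map_smul' c f := by funext j; simp [mul_left_comm]

theorem sgn_E1 (n i : ℕ) : cgSgn k n 0 (cgE1 k n i) = (-1:k)^i • cgE1 k n i := by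
  funext j
  by_cases h : (j:ℕ) = i <;> simp [cgSgn, cgE1, h]

noncomputable def cgBasis (k : Type*) [Field k] (n m : ℕ) :
    Module.Basis (Fin (n+1) × Fin (m+1)) k ((Fin (n+1) → k) ⊗[k] (Fin (m+1) → k)) :=
  (Pi.basisFun k (Fin (n+1))).tensorProduct (Pi.basisFun k (Fin (m+1)))

theorem cgBasis_apply (n m : ℕ) (p) : cgBasis k n m p = cgE k n m p.1 p.2 := by
  have : ∀ (n : ℕ) (i : Fin (n+1)), Pi.single i (1:k) = cgE1 k n i := by
    intro n i
    funext j
    simp [cgE1, Pi.single_apply, Fin.ext_iff]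
  obtain ⟨p, q⟩ := p
  simp [cgBasis, cgE, this, Module.Basis.tensorProduct_apply]

noncomputable def cgProj (k : Type*) [Field k] (n m D : ℕ) : 
    (Fin (n+1) → k) ⊗[k] (Fin (m+1) → k) →ₗ[k] (Fin (n+1) → k) ⊗[k] (Fin (m+1) → k) :=
  (cgBasis k n m).constr k (fun p => if (p.1:ℕ) + p.2 = D then cgE k n m p.1 p.2 else 0)

theorem proj_E (n m D i j : ℕ) :
    cgProj k n m D (cgE k n m i j) = if i + j = D then cgE k n m i j else 0 := by
  by_cases hi : n < i
  · simp [cgE_zero1 hi]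
  by_cases hj : m < j
  · simp [cgE_zero2 hj]
  have := cgBasis_apply (k := k) n m (⟨i, by omega⟩, ⟨j, by omega⟩)
  simp only at this
  rw [← this, cgProj, Module.Basis.constr_basis]
  simp [this]

def cgZ (k : Type*) [Field k] (n m : ℕ) : 
    (Fin (n+1) → k) ⊗[k] (Fin (m+1) → k) →ₗ[k] (Fin (n+1) → k) ⊗[k] (Fin (m+1) → k) :=
  TensorProduct.map (shiftMap k n) LinearMap.id + TensorProduct.map (cgSgn k n 0) (shiftMap k m)

theorem Z_E (n m i j : ℕ) : cgZ k n m (cgE k n m i j) =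
    cgE k n m (i+1) j + (-1:k)^i • cgE k n m i (j+1) := by
  simp [cgZ, cgE, shift_E1, sgn_E1, TensorProduct.smul_tmul']

theorem ZZ_E (n m i j : ℕ) : cgZ k n m (cgZ k n m (cgE k n m i j)) =
    cgE k n m (i+2) j + cgE k n m i (j+2) := by
  rw [Z_E, map_add, map_smul, Z_E, Z_E]
  have : (-1:k)^i * (-1)^i = 1 := by rw [← mul_pow]; simp
  simp only [pow_succ, smul_add, smul_smul, this]
  module

theorem E1_mem (n i r : ℕ) (h : i % 2 = r) : cgE1 k n i ∈ stringPart k n 0 r := by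
  simp only [stringPart, Submodule.mem_pi]
  intro j _
  by_cases hj : (j:ℕ) = i
  · simp [hj, h]
  · simp [cgE1, hj]

theorem z_eq (n m : ℕ) (z : ((Fin (n+1) → k) ⊗[k] (Fin (m+1) → k)) →ₗ[k]
         ((Fin (n+1) → k) ⊗[k] (Fin (m+1) → k)))
    (hz : IsSuperTensorMap k (stringPart k n 0 0) (stringPart k n 0 1)
      (shiftMap k n) (shiftMap k m) z) : z = cgZ k n m := by
  apply (cgBasis k n m).ext
  intro p
  rw [cgBasis_apply, Z_E]
  rcases Nat.mod_two_eq_zero_or_one p.1 with h | h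
  · rw [cgE, hz.1 _ (E1_mem _ _ _ h), shift_E1, shift_E1, (Nat.even_iff.mpr h).neg_one_pow]
    simp [cgE]
  · rw [cgE, hz.2 _ (E1_mem _ _ _ h), shift_E1, shift_E1, (Nat.odd_iff.mpr h).neg_one_pow]
    simp only [cgE]
    module

def cgT (k : Type*) [Field k] (n m d : ℕ) : Submodule k ((Fin (n+1) → k) ⊗[k] (Fin (m+1) → k)) :=
  Submodule.span k {v | ∃ i j, i + j = d ∧ v = cgE k n m i j}

def cgS (k : Type*) [Field k] (n m e d : ℕ) :
    Submodule k ((Fin (n+1) → k) ⊗[k] (Fin (m+1) → k)) :=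
  Submodule.span k {v | ∃ i j, i + j = d ∧ i % 2 = e ∧ v = cgE k n m i j}

theorem T_E (n m i j d : ℕ) (h : i + j = d) : cgE k n m i j ∈ cgT k n m d :=
  Submodule.subset_span ⟨i, j, h, rfl⟩

theorem S_E (n m i j e d : ℕ) (h : i + j = d) (h' : i % 2 = e) : cgE k n m i j ∈ cgS k n m e d :=
  Submodule.subset_span ⟨i, j, h, h', rfl⟩

/-- two linear maps agreeing on generators of `cgS` -/
theorem S_eq {n m e d : ℕ} {U : Type*} [AddCommGroup U] [Module k U]
    (f g : ((Fin (n+1) → k) ⊗[k] (Fin (m+1) → k)) →ₗ[k] U)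
    (h : ∀ i j, i ≤ n → j ≤ m → i + j = d → i % 2 = e → f (cgE k n m i j) = g (cgE k n m i j))
    {v} (hv : v ∈ cgS k n m e d) : f v = g v := by
  refine LinearMap.eqOn_span (s := {v | ∃ i j, i + j = d ∧ i % 2 = e ∧ v = cgE k n m i j}) ?_ hv
  rintro _ ⟨i, j, h1, h2, rfl⟩
  by_cases hi : n < i
  · simp [cgE_zero1 hi]
  by_cases hj : m < j
  · simp [cgE_zero2 hj]
  exact h i j (by omega) (by omega) h1 h2

theorem T_eq {n m d : ℕ} {U : Type*} [AddCommGroup U] [Module k U]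
    (f g : ((Fin (n+1) → k) ⊗[k] (Fin (m+1) → k)) →ₗ[k] U)
    (h : ∀ i j, i + j = d → f (cgE k n m i j) = g (cgE k n m i j))
    {v} (hv : v ∈ cgT k n m d) : f v = g v := by
  refine LinearMap.eqOn_span (s := {v | ∃ i j, i + j = d ∧ v = cgE k n m i j}) ?_ hv
  rintro _ ⟨i, j, h1, rfl⟩
  exact h i j h1

theorem S_map {n m e d e' d' : ℕ} 
    (f : ((Fin (n+1) → k) ⊗[k] (Fin (m+1) → k)) →ₗ[k] (Fin (n+1) → k) ⊗[k] (Fin (m+1) → k))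
    (h : ∀ i j, i ≤ n → j ≤ m → i + j = d → i % 2 = e → f (cgE k n m i j) ∈ cgS k n m e' d')
    {v} (hv : v ∈ cgS k n m e d) : f v ∈ cgS k n m e' d' := by
  have : cgS k n m e d ≤ (cgS k n m e' d').comap f := by
    refine Submodule.span_le.mpr ?_
    rintro _ ⟨i, j, h1, h2, rfl⟩
    by_cases hi : n < i
    · simp [cgE_zero1 hi]
    by_cases hj : m < j
    · simp [cgE_zero2 hj]
    exact h i j (by omega) (by omega) h1 h2
  exact this hv

theorem T_Z {n m d : ℕ} {v} (hv : v ∈ cgT k n m d) : cgZ k n m v ∈ cgT k n m (d+1) := by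
  have : cgT k n m d ≤ (cgT k n m (d+1)).comap (cgZ k n m) := by
    refine Submodule.span_le.mpr ?_
    rintro _ ⟨i, j, h1, rfl⟩
    simp only [Submodule.comap_coe, Set.mem_preimage, SetLike.mem_coe, Z_E]
    exact add_mem (T_E _ _ _ _ _ (by omega)) (Submodule.smul_mem _ _ (T_E _ _ _ _ _ (by omega)))
  exact this hv

theorem T_Zpow {n m d : ℕ} {v} (hv : v ∈ cgT k n m d) (r : ℕ) :
    (cgZ k n m ^ r) v ∈ cgT k n m (d+r) := by
  induction r with
  | zero => simpa using hv
  | succ r ih => rw [pow_succ']; exact T_Z ih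

theorem T_proj {n m d D : ℕ} {v} (hv : v ∈ cgT k n m d) :
    cgProj k n m D v = if d = D then v else 0 := by
  split_ifs with h
  · exact T_eq (cgProj k n m D) LinearMap.id (by intro i j hij; rw [proj_E, if_pos (by omega)]; rfl) hv
  · exact T_eq (cgProj k n m D) 0 (by intro i j hij; rw [proj_E, if_neg (by omega)]; rfl) hv

def c1 (k : Type*) [Field k] (a i : ℕ) : k := ((i/2 : ℕ):k) * ((a:k) + 1 - ((i/2 : ℕ):k))
def c2 (k : Type*) [Field k] (b j : ℕ) : k :=
  ((j/2 : ℕ):k) * ((b:k) - ((j%2 : ℕ):k) + 1 - ((j/2 : ℕ):k))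

def cgF (k : Type*) [Field k] (a b : ℕ) :
    (Fin (2*a+1+1) → k) ⊗[k] (Fin (2*b+1) → k) →ₗ[k] (Fin (2*a+1+1) → k) ⊗[k] (Fin (2*b+1) → k) :=
  TensorProduct.map (cgDown (2*a+1) 2 (c1 k a)) LinearMap.id +
  TensorProduct.map LinearMap.id (cgDown (2*b) 2 (c2 k b))

theorem c1_small (a i : ℕ) (h : i < 2) : c1 k a i = 0 := by
  have : i / 2 = 0 := by omega
  simp [c1, this]

theorem c2_small (a i : ℕ) (h : i < 2) : c2 k a i = 0 := by
  have : i / 2 = 0 := by omega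
  simp [c2, this]

theorem F_E (a b p q : ℕ) (hp : p ≤ 2*a+3) (hq : q ≤ 2*b+2) :
    cgF k a b (cgE k (2*a+1) (2*b) p q) = c1 k a p • cgE k (2*a+1) (2*b) (p-2) q
      + c2 k b q • cgE k (2*a+1) (2*b) p (q-2) := by
  by_cases h1 : 2*a+1 < p
  · have : p / 2 = a + 1 := by omega
    simp [cgE_zero1 h1, c1, this]
  by_cases h2 : 2*b < q
  · have : c2 k b q = 0 := by
      rcases (by omega : q = 2*b+1 ∨ q = 2*b+2) with rfl | rfl
      · have e1 : (2*b+1)/2 = b := by omega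
        have e2 : (2*b+1)%2 = 1 := by omega
        simp [c2, e1, e2]
      · have e1 : (2*b+2)/2 = b+1 := by omega
        have e2 : (2*b+2)%2 = 0 := by omega
        simp [c2, e1, e2]
    simp [cgE_zero2 h2, this]
  simp only [cgF, cgE, LinearMap.add_apply, TensorProduct.map_tmul, LinearMap.id_apply]
  rw [down_E1 _ _ _ _ (by omega) (c1_small a p), down_E1 _ _ _ _ (by omega) (c2_small b q)]
  simp [TensorProduct.smul_tmul']

theorem c1_fix (a b p q : ℕ) (m : ℕ) :
    c1 k a p • cgE k b m (p-2+2) q = c1 k a p • cgE k b m p q := by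
  by_cases h : p < 2
  · simp [c1_small a p h]
  · rw [show p - 2 + 2 = p by omega]

theorem c2_fix (a b p q : ℕ) (m : ℕ) :
    c2 k a q • cgE k b m p (q-2+2) = c2 k a q • cgE k b m p q := by
  by_cases h : q < 2
  · simp [c2_small a q h]
  · rw [show q - 2 + 2 = q by omega]

theorem FL_E (a b p q : ℕ) (hp : p ≤ 2*a+1) (hq : q ≤ 2*b) :
    cgF k a b (cgZ k _ _ (cgZ k _ _ (cgE k (2*a+1) (2*b) p q)))
    - cgZ k _ _ (cgZ k _ _ (cgF k a b (cgE k (2*a+1) (2*b) p q))) =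
    (((a + b + p % 2 : ℕ):k) - ((p + q : ℕ) : k)) • cgE k (2*a+1) (2*b) p q := by
  rw [F_E _ _ _ _ (by omega) (by omega), ZZ_E, map_add, F_E _ _ _ _ (by omega) (by omega),
    F_E _ _ _ _ (by omega) (by omega)]
  simp only [map_add, map_smul, ZZ_E, smul_add, c1_fix, c2_fix, Nat.add_sub_cancel]
  have key : (((a + b + p % 2 : ℕ):k) - ((p + q : ℕ) : k)) =
    c1 k a (p+2) - c1 k a p + (c2 k b (q+2) - c2 k b q) := by
    have e1 : (p+2)/2 = p/2+1 := by omega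
    have e2 : (q+2)/2 = q/2+1 := by omega
    have e3 : (q+2)%2 = q%2 := by omega
    have e4 : p = 2*(p/2) + p%2 := by omega
    have e5 : q = 2*(q/2) + q%2 := by omega
    have e4' : (p:k) = 2*((p/2 : ℕ):k) + ((p%2 : ℕ) : k) := by exact_mod_cast congrArg (Nat.cast (R := k)) e4
    have e5' : (q:k) = 2*((q/2 : ℕ):k) + ((q%2 : ℕ) : k) := by exact_mod_cast congrArg (Nat.cast (R := k)) e5
    simp only [c1, c2, e1, e2, e3]
    push_cast only [Nat.cast_add, Nat.cast_one]
    rw [e4', e5']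
    ring
  rw [key]
  module

theorem cg_lef2 [CharZero k] (a b e : ℕ) (d r : ℕ) (h : r + d ≤ a + b + e) (v)
    (hv : v ∈ cgS k (2*a+1) (2*b) e d)
    (h0 : ((cgZ k (2*a+1) (2*b) ^ 2) ^ r) v = 0) : v = 0 := by
  have hZ2 : ∀ v, (cgZ k (2*a+1) (2*b) ^ 2) v = cgZ k _ _ (cgZ k _ _ v) := by
    intro v; rw [pow_two]; rfl
  refine cg_lef (cgS k (2*a+1) (2*b) e) (cgZ k _ _ ^ 2) (cgF k a b) (a+b+e) ?_ ?_ ?_ ?_ d r h v hv h0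
  · intro d v hv
    refine S_map _ ?_ hv
    intro i j hi hj hij he
    rw [F_E _ _ _ _ (by omega) (by omega)]
    refine add_mem ?_ ?_
    · by_cases h : i < 2
      · simp [c1_small _ _ h]
      · exact Submodule.smul_mem _ _ (S_E _ _ _ _ _ _ (by omega) (by omega))
    · by_cases h : j < 2
      · simp [c2_small _ _ h]
      · exact Submodule.smul_mem _ _ (S_E _ _ _ _ _ _ (by omega) (by omega))
  · intro d hd v hv
    refine S_eq (cgF k a b) 0 ?_ hv
    intro i j hi hj hij he
    rw [F_E _ _ _ _ (by omega) (by omega), c1_small _ _ (by omega), c2_small _ _ (by omega)]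
    simp
  · intro d v hv
    refine S_map _ ?_ hv
    intro i j hi hj hij he
    rw [hZ2, ZZ_E]
    exact add_mem (S_E _ _ _ _ _ _ (by omega) (by omega)) (S_E _ _ _ _ _ _ (by omega) (by omega))
  · intro d v hv
    refine S_eq (cgF k a b ∘ₗ (cgZ k _ _ ^ 2) - (cgZ k _ _ ^ 2) ∘ₗ cgF k a b) 
      ((((a+b+e : ℕ):k) - d) • LinearMap.id) ?_ hv
    intro i j hi hj hij he
    have := FL_E (k := k) a b i j hi hj
    rw [he, hij] at this
    simpa only [LinearMap.sub_apply, LinearMap.comp_apply, hZ2, LinearMap.smul_apply,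
      LinearMap.id_apply] using this

theorem S_Zpow {n m e d : ℕ} {v} (hv : v ∈ cgS k n m e d) (r : ℕ) :
    ((cgZ k n m ^ 2)^ r) v ∈ cgS k n m e (d+2*r) := by
  induction r with
  | zero => simpa using hv
  | succ r ih =>
    rw [pow_succ', Module.End.mul_apply]
    refine S_map _ ?_ ih
    intro i j hi hj hij he
    rw [pow_two, Module.End.mul_apply, ZZ_E]
    exact add_mem (S_E _ _ _ _ _ _ (by omega) (by omega)) (S_E _ _ _ _ _ _ (by omega) (by omega))

theorem T_split {n m d : ℕ} {v} (hv : v ∈ cgT k n m d) :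
    ∃ v0 ∈ cgS k n m 0 d, ∃ v1 ∈ cgS k n m 1 d, v0 + v1 = v := by
  rw [← Submodule.mem_sup]
  have : cgT k n m d ≤ cgS k n m 0 d ⊔ cgS k n m 1 d := by
    refine Submodule.span_le.mpr ?_
    rintro _ ⟨i, j, h1, rfl⟩
    rcases Nat.mod_two_eq_zero_or_one i with h | h
    · exact Submodule.mem_sup_left (S_E _ _ _ _ _ _ h1 h)
    · exact Submodule.mem_sup_right (S_E _ _ _ _ _ _ h1 h)
  exact this hv

theorem eq_zero_of_neg [CharZero k] {V : Type*} [AddCommGroup V] [Module k V] {x y : V}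
    (h1 : x + y = 0) (h2 : x - y = 0) : x = 0 ∧ y = 0 := by
  have hx : (2:k) • x = 0 := by
    have : (2:k) • x = (x + y) + (x - y) := by module
    rw [this, h1, h2, add_zero]
  have := (smul_eq_zero.mp hx).resolve_left two_ne_zero
  subst this
  simpa using h1

theorem cg_main [CharZero k] (a b d : ℕ) (hd : d ≤ a + b) (v) (hv : v ∈ cgT k (2*a+1) (2*b) d)
    (h0 : (cgZ k (2*a+1) (2*b) ^ (2*(a+b-d)+1)) v = 0) : v = 0 := by
  obtain ⟨v0, hv0, v1, hv1, rfl⟩ := T_split hv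
  set r := a + b - d with hr
  set Z := cgZ k (2*a+1) (2*b) with hZ
  have hu0 := S_Zpow hv0 r
  have hu1 := S_Zpow hv1 r
  rw [← hZ] at hu0 hu1
  rw [pow_succ', pow_mul, Module.End.mul_apply, map_add] at h0
  set u0 := ((Z^2)^r) v0 with hu0'
  set u1 := ((Z^2)^r) v1 with hu1'
  have hL0 : Z (Z u0) + Z (Z u1) = 0 := by rw [← map_add, ← map_add, h0, map_zero]
  let P : (Fin (2*a+1+1) → k) ⊗[k] (Fin (2*b+1) → k) →ₗ[k] (Fin (2*a+1+1) → k) ⊗[k] (Fin (2*b+1) → k)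
    := TensorProduct.map (cgSgn k _ 0) LinearMap.id
  have hP : ∀ i j, P (cgE k _ _ i j) = (-1:k)^i • cgE k _ _ i j := by
    intro i j
    simp [P, cgE, sgn_E1, TensorProduct.smul_tmul']
  have hPL0 : P (Z (Z u0)) = Z (Z u0) := by
    refine S_eq (P ∘ₗ Z ∘ₗ Z) (Z ∘ₗ Z) ?_ hu0
    intro i j hi hj hij he
    have : (-1:k)^i = 1 := (Nat.even_iff.mpr he).neg_one_pow
    simp [hZ, ZZ_E, hP, pow_add, this]
  have hPL1 : P (Z (Z u1)) = - Z (Z u1) := by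
    refine S_eq (P ∘ₗ Z ∘ₗ Z) (-(Z ∘ₗ Z)) ?_ hu1
    intro i j hi hj hij he
    have : (-1:k)^i = -1 := (Nat.odd_iff.mpr he).neg_one_pow
    simp only [LinearMap.comp_apply, LinearMap.neg_apply, hZ, ZZ_E, map_add, hP, pow_add, this]
    module
  have hL1 : Z (Z u0) - Z (Z u1) = 0 := by
    have := congrArg P hL0
    rw [map_add, hPL0, hPL1, map_zero] at this
    rw [sub_eq_add_neg, this]
  have hv1z : v1 = 0 := by
    refine cg_lef2 a b 1 d (r+1) (by omega) v1 hv1 ?_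
    rw [pow_succ', Module.End.mul_apply, ← hZ, ← hu1', pow_two, Module.End.mul_apply]
    exact (eq_zero_of_neg (k := k) hL0 hL1).2
  have hu1z : u1 = 0 := by rw [hu1', hv1z, map_zero]
  rw [hu1z, add_zero] at h0
  let X : (Fin (2*a+1+1) → k) ⊗[k] (Fin (2*b+1) → k) →ₗ[k] (Fin (2*a+1+1) → k) ⊗[k] (Fin (2*b+1) → k)
    := TensorProduct.map (shiftMap k _) LinearMap.id
  let G : (Fin (2*a+1+1) → k) ⊗[k] (Fin (2*b+1) → k) →ₗ[k] (Fin (2*a+1+1) → k) ⊗[k] (Fin (2*b+1) → k)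
    := TensorProduct.map (cgDown _ 1 (fun i => if i = 0 then 0 else 1)) LinearMap.id
  have hX : ∀ i j, X (cgE k _ _ i j) = cgE k _ _ (i+1) j := by
    intro i j
    simp [X, cgE, shift_E1]
  have h3 : Z u0 - P (Z u0) = (2:k) • X u0 := by
    refine S_eq (Z - P ∘ₗ Z) ((2:k) • X) ?_ hu0
    intro i j hi hj hij he
    have : (-1:k)^i = 1 := (Nat.even_iff.mpr he).neg_one_pow
    simp only [LinearMap.sub_apply, LinearMap.comp_apply, hZ, Z_E, hP, LinearMap.smul_apply, hX,
      map_add, map_smul, pow_succ, this]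
    module
  rw [h0, map_zero, sub_zero] at h3
  have hXu : X u0 = 0 := (smul_eq_zero.mp h3.symm).resolve_left two_ne_zero
  have hG : G (X u0) = u0 := by
    refine S_eq (G ∘ₗ X) LinearMap.id ?_ hu0
    intro i j hi hj hij he
    simp only [LinearMap.comp_apply, hX, LinearMap.id_apply]
    simp only [G, cgE, TensorProduct.map_tmul]
    rw [down_E1 _ _ _ _ (by omega) (by intro h; simp; omega)]
    simp
  have hu0z : u0 = 0 := by rw [← hG, hXu, map_zero]
  have hv0z : v0 = 0 := cg_lef2 a b 0 d r (by omega) v0 hv0 hu0z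
  rw [hv0z, hv1z, add_zero]

theorem cg_exists [CharZero k] (n m d : ℕ) (hn : d ≤ n) (hm : d ≤ m) :
    ∃ w ∈ cgT k n m d, w ≠ 0 ∧ (cgZ k n m ^ (n + m - 2 * d + 1)) w = 0 := by
  let f : (Fin (d+1) → k) →ₗ[k] ((Fin (n+1) → k) ⊗[k] (Fin (m+1) → k)) :=
    Fintype.linearCombination k (fun i : Fin (d+1) => cgE k n m i (d - i))
  have hf : Function.Injective f := by
    rw [← LinearMap.ker_eq_bot]
    have : LinearIndependent k (fun i : Fin (d+1) => cgE k n m i (d - i)) := by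
      have h1 := (cgBasis k n m).linearIndependent.comp
        (fun i : Fin (d+1) => ((⟨i, by omega⟩ : Fin (n+1)), (⟨d - i, by omega⟩ : Fin (m+1)))) (by
          intro i j h
          simp only [Prod.mk.injEq, Fin.mk.injEq] at h
          exact Fin.ext h.1)
      convert h1 using 2 with i
      simp [cgBasis_apply]
    exact LinearMap.ker_eq_bot.mpr ((LinearIndependent.fintypeLinearCombination_injective this))
  have hfT : ∀ x, f x ∈ cgT k n m d := by
    intro x
    simp only [f, Fintype.linearCombination_apply]
    refine Submodule.sum_mem _ (fun i _ => Submodule.smul_mem _ _ (T_E _ _ _ _ _ (by omega)))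
  set R := cgZ k n m ^ (n + m - 2 * d + 1)
  let U := Submodule.span k (Set.range (fun i : Fin d => cgE k n m (n + 1 - d + i) (m - i)))
  have hU : cgT k n m (n+m+1-d) ≤ U := by
    refine Submodule.span_le.mpr ?_
    rintro _ ⟨i, j, h1, rfl⟩
    by_cases hi : n < i
    · simp [cgE_zero1 hi]
    by_cases hj : m < j
    · simp [cgE_zero2 hj]
    refine Submodule.subset_span ⟨⟨m - j, by omega⟩, ?_⟩
    simp only
    congr 1 <;> omega
  have hRU : ∀ x, (R ∘ₗ f) x ∈ U := by
    intro x
    apply hU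
    have := T_Zpow (hfT x) (n + m - 2 * d + 1)
    rw [show d + (n+m-2*d+1) = n+m+1-d by omega] at this
    exact this
  have hlt : Module.finrank k U < Module.finrank k (Fin (d+1) → k) := by
    have : Module.finrank k U ≤ d := by
      simpa [Set.finrank] using finrank_range_le_card (R := k) (fun i : Fin d => cgE k n m (n + 1 - d + i) (m - i))
    simp; omega
  have hk : LinearMap.ker (R ∘ₗ f) ≠ ⊥ := by
    intro hbot
    have h1 := LinearMap.finrank_range_of_inj (LinearMap.ker_eq_bot.mp hbot)
    have h2 : LinearMap.range (R ∘ₗ f) ≤ U := by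
      rintro _ ⟨x, rfl⟩
      exact hRU x
    have h3 := Submodule.finrank_mono h2
    omega
  obtain ⟨x, hx, hx0⟩ := (Submodule.ne_bot_iff _).mp hk
  refine ⟨f x, hfT x, fun h => hx0 (hf (by rw [h, map_zero])), ?_⟩
  exact LinearMap.mem_ker.mp hx

theorem mem_stringPart (n e r : ℕ) (f : Fin (n+1) → k) :
    f ∈ stringPart k n e r ↔ ∀ j : Fin (n+1), ((j:ℕ) + e) % 2 ≠ r → f j = 0 := by
  simp only [stringPart, Submodule.mem_pi]
  constructor
  · intro h j hj
    simpa [hj] using h j trivial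
  · intro h j _
    by_cases hj : ((j:ℕ) + e) % 2 = r
    · simp [hj]
    · simpa [hj] using h j hj

theorem sgn_string (n e r : ℕ) (f : Fin (n+1) → k) (hf : f ∈ stringPart k n e r) :
    cgSgn k n e f = (-1:k)^r • f := by
  rw [mem_stringPart] at hf
  funext j
  by_cases hj : ((j:ℕ) + e) % 2 = r
  · simp only [cgSgn, LinearMap.coe_mk, AddHom.coe_mk, Pi.smul_apply, smul_eq_mul]
    rw [← hj, ← neg_one_pow_eq_pow_mod_two]
  · simp [cgSgn, hf j hj]

theorem string_of_sgn [CharZero k] (n e r : ℕ) (hr : r < 2) (f : Fin (n+1) → k)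
    (hf : cgSgn k n e f = (-1:k)^r • f) : f ∈ stringPart k n e r := by
  rw [mem_stringPart]
  intro j hj
  have := congrFun hf j
  simp only [cgSgn, LinearMap.coe_mk, AddHom.coe_mk, Pi.smul_apply, smul_eq_mul] at this
  rw [neg_one_pow_eq_pow_mod_two] at this
  have h2 : ((j:ℕ) + e) % 2 = 1 - r := by omega
  rw [h2] at this
  interval_cases r
  · simp only [pow_one, pow_zero, Nat.sub_zero, one_mul, neg_mul] at this
    exact self_eq_neg.mp this.symm
  · simp only [pow_one, pow_zero, Nat.sub_self, one_mul, neg_mul] at this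
    exact self_eq_neg.mp this

theorem cg_assemble [CharZero k] (a b c : ℕ) (n ε d : Fin c → ℕ) (hdinj : Function.Injective d)
    (hd1 : ∀ i, d i ≤ 2*a+1) (hd2 : ∀ i, d i ≤ 2*b)
    (hn : ∀ i, n i + 2 * d i = 2*a+1+2*b) (hε : ∀ i, ε i = d i % 2)
    (hdim : ∑ i, (n i + 1) = (2*a+2)*(2*b+1)) :
    PairIso k
      (tensorEven k (stringPart k (2*a+1) 0 0) (stringPart k (2*a+1) 0 1)
        (stringPart k (2*b) 0 0) (stringPart k (2*b) 0 1))
      (tensorOdd k (stringPart k (2*a+1) 0 0) (stringPart k (2*a+1) 0 1)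
        (stringPart k (2*b) 0 0) (stringPart k (2*b) 0 1))
      (cgZ k (2*a+1) (2*b)) (multiPart k n ε 0) (multiPart k n ε 1) (multiShift k n) := by
  have hex : ∀ i, ∃ w ∈ cgT k (2*a+1) (2*b) (d i), w ≠ 0 ∧
      (cgZ k (2*a+1) (2*b) ^ (n i + 1)) w = 0 := by
    intro i
    obtain ⟨w, h1, h2, h3⟩ := cg_exists (k := k) (2*a+1) (2*b) (d i) (hd1 i) (hd2 i)
    refine ⟨w, h1, h2, ?_⟩
    rw [show n i + 1 = 2*a+1+2*b-2*d i+1 by have := hn i; omega]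
    exact h3
  choose w hwT hw0 hwk using hex
  set Z := cgZ k (2*a+1) (2*b) with hZ
  have hwk' : ∀ i r, n i < r → (Z^r) (w i) = 0 := by
    intro i r hr
    obtain ⟨t, rfl⟩ : ∃ t, r = t + (n i + 1) := ⟨r - (n i + 1), by omega⟩
    rw [pow_add, Module.End.mul_apply, hwk, map_zero]
  let ψ : ((i : Fin c) → (Fin (n i + 1) → k)) →ₗ[k]
      ((Fin (2*a+1+1) → k) ⊗[k] (Fin (2*b+1) → k)) :=
    ∑ i, (Fintype.linearCombination k (fun j : Fin (n i + 1) => (Z^(j:ℕ)) (w i))) ∘ₗ LinearMap.proj i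
  have hψ : ∀ f, ψ f = ∑ i, ∑ j : Fin (n i + 1), f i j • (Z^(j:ℕ)) (w i) := by
    intro f
    simp [ψ, Fintype.linearCombination_apply]
  have hinj : Function.Injective ψ := by
    rw [injective_iff_map_eq_zero]
    intro f hf
    have key : ∀ D i0, d i0 = D → ∀ j0, f i0 j0 = 0 := by
      intro D
      induction D using Nat.strong_induction_on with
      | _ D ih =>
        intro i0 hi0 j0
        have h1 := congrArg (fun v => (Z^(n i0 - j0)) (cgProj k _ _ (d i0 + j0) v)) hf
        simp only [hψ, map_sum, map_smul, map_zero] at h1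
        have h2 : ∀ i (j : Fin (n i + 1)), cgProj k _ _ (d i0 + j0) ((Z^(j:ℕ)) (w i)) =
            if d i + j = d i0 + j0 then (Z^(j:ℕ)) (w i) else 0 := fun i j => T_proj (T_Zpow (hwT i) j)
        simp only [h2] at h1
        have hj0 := j0.2
        rw [Finset.sum_eq_single i0, Finset.sum_eq_single j0] at h1
        · rw [if_pos rfl, ← Module.End.mul_apply, ← pow_add,
            show n i0 - j0 + j0 = n i0 by omega] at h1
          refine (smul_eq_zero.mp h1).resolve_right ?_
          intro h3
          have := hn i0
          refine hw0 i0 (cg_main a b (d i0) (by omega) _ (hwT i0) ?_)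
          rw [← hZ, show 2*(a+b-d i0)+1 = n i0 by omega]
          exact h3
        · intro j _ hj
          rw [if_neg, map_zero, smul_zero]
          intro h
          exact hj (Fin.ext (by omega))
        · simp
        · intro i _ hi
          refine Finset.sum_eq_zero (fun j _ => ?_)
          have hne : d i ≠ d i0 := fun h => hi (hdinj h)
          rcases lt_or_gt_of_ne hne with h | h
          · rw [ih (d i) (by omega) i rfl j, zero_smul]
          · split_ifs with h'
            · rw [← Module.End.mul_apply, ← pow_add, hwk', smul_zero]
              have := hn i0
              have := hn i
              omega
            · simp
        · simp
    funext i j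
    exact key _ i rfl j
  have hfin : Module.finrank k ((i : Fin c) → (Fin (n i + 1) → k)) =
      Module.finrank k ((Fin (2*a+1+1) → k) ⊗[k] (Fin (2*b+1) → k)) := by
    rw [Module.finrank_pi_fintype, Module.finrank_tensorProduct]
    simpa using hdim
  let e := LinearEquiv.ofBijective ψ ⟨hinj,
    (LinearMap.injective_iff_surjective_of_finrank_eq_finrank hfin).mp hinj⟩
  have he : ∀ f, e f = ψ f := fun f => rfl
  -- parity operators
  let σ : ((Fin (2*a+1+1) → k) ⊗[k] (Fin (2*b+1) → k)) →ₗ[k]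
      ((Fin (2*a+1+1) → k) ⊗[k] (Fin (2*b+1) → k)) :=
    TensorProduct.map (cgSgn k _ 0) (cgSgn k _ 0)
  let τ : ((i : Fin c) → (Fin (n i + 1) → k)) →ₗ[k] ((i : Fin c) → (Fin (n i + 1) → k)) :=
    LinearMap.pi (fun i => (cgSgn k (n i) (ε i)).comp (LinearMap.proj i))
  have hσT : ∀ D v, v ∈ cgT k (2*a+1) (2*b) D → σ v = (-1:k)^D • v := by
    intro D v hv
    refine T_eq σ ((-1:k)^D • LinearMap.id) ?_ hv
    intro i j hij
    simp [σ, cgE, sgn_E1, ← hij, pow_add, TensorProduct.smul_tmul', TensorProduct.tmul_smul, smul_smul, mul_comm]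
  have hτ : ∀ f, ψ (τ f) = σ (ψ f) := by
    intro f
    simp only [hψ, map_sum, map_smul]
    refine Finset.sum_congr rfl (fun i _ => Finset.sum_congr rfl (fun j _ => ?_))
    rw [hσT _ _ (T_Zpow (hwT i) j), smul_smul]
    congr 1
    simp only [τ, cgSgn, LinearMap.pi_apply, LinearMap.comp_apply, LinearMap.proj_apply,
      LinearMap.coe_mk, AddHom.coe_mk]
    rw [mul_comm, hε, neg_one_pow_eq_pow_mod_two, neg_one_pow_eq_pow_mod_two (n := d i + j)]
    congr 2
    omega
  have hτ' : ∀ v, τ (e.symm v) = e.symm (σ v) := by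
    intro v
    apply e.injective
    rw [e.apply_symm_apply, he, hτ, ← he, e.apply_symm_apply]
  have hpart : ∀ r, r < 2 → ∀ v, σ v = (-1:k)^r • v → e.symm v ∈ multiPart k n ε r := by
    intro r hr v hv
    have h1 := hτ' v
    rw [hv, map_smul] at h1
    simp only [multiPart, Submodule.mem_pi]
    intro i _
    apply string_of_sgn _ _ _ hr
    exact congrFun h1 i
  refine ⟨e.symm, ?_, ?_, ?_⟩
  · intro v hv
    refine hpart 0 (by norm_num) v ?_
    refine LinearMap.eqOn_span (f := σ) (g := (-1:k)^0 • LinearMap.id) ?_ hv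
    rintro _ (⟨x, hx, y, hy, rfl⟩ | ⟨x, hx, y, hy, rfl⟩) <;>
      simp [σ, sgn_string _ _ _ _ hx, sgn_string _ _ _ _ hy, TensorProduct.neg_tmul, TensorProduct.tmul_neg]
  · intro v hv
    refine hpart 1 (by norm_num) v ?_
    refine LinearMap.eqOn_span (f := σ) (g := (-1:k)^1 • LinearMap.id) ?_ hv
    rintro _ (⟨x, hx, y, hy, rfl⟩ | ⟨x, hx, y, hy, rfl⟩) <;>
      simp [σ, sgn_string _ _ _ _ hx, sgn_string _ _ _ _ hy, TensorProduct.neg_tmul, TensorProduct.tmul_neg]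
  · intro v
    obtain ⟨f, rfl⟩ := e.surjective v
    rw [e.symm_apply_apply]
    apply e.injective
    rw [e.apply_symm_apply, he, he, hψ, hψ, map_sum]
    refine Finset.sum_congr rfl (fun i _ => ?_)
    rw [map_sum, Fin.sum_univ_castSucc, Fin.sum_univ_succ]
    have hA : ∀ j : Fin (n i + 1), Z (f i j • (Z^(j:ℕ)) (w i)) = f i j • (Z^((j:ℕ)+1)) (w i) := by
      intro j
      rw [map_smul, pow_succ', Module.End.mul_apply]
    simp only [hA]
    rw [Fin.val_last, hwk, smul_zero, add_zero]
    have hB : multiShift k n f i 0 = 0 := by simp [multiShift, shiftMap]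
    rw [hB, zero_smul, zero_add]
    refine Finset.sum_congr rfl (fun j _ => ?_)
    have hC : multiShift k n f i j.succ = f i j.castSucc := by
      simp [multiShift, shiftMap]
      rfl
    rw [hC]
    simp

theorem cg_sum (c μ : ℕ) : ∑ i : Fin c, (2*(μ + i.1) + 1 + 1) = c * (2*μ + c + 1) := by
  induction c with
  | zero => simp
  | succ c ih =>
    rw [Fin.sum_univ_castSucc]
    simp only [Fin.val_castSucc, Fin.val_last]
    rw [ih]
    ring

end CG

/-- **Clebsch–Gordan decomposition for `𝔾ₐ^{(1|1)}`, odd ⊗ even case**: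
`M_{2a+1} ⊗ M_{2b} ≅ ⊕_{s=min(|a−b|,|a−b+1|)}^{a+b} Π^{(a+b−s) mod 2} M_{2s+1}`. -/
theorem clebsch_gordan_odd_even {k : Type*} [Field k] [CharZero k] (a b : ℕ)
    (z : ((Fin (2*a+1+1) → k) ⊗[k] (Fin (2*b+1) → k)) →ₗ[k]
         ((Fin (2*a+1+1) → k) ⊗[k] (Fin (2*b+1) → k)))
    (hz : IsSuperTensorMap k (stringPart k (2*a+1) 0 0) (stringPart k (2*a+1) 0 1)
      (shiftMap k (2*a+1)) (shiftMap k (2*b)) z) :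
    PairIso k
      (tensorEven k (stringPart k (2*a+1) 0 0) (stringPart k (2*a+1) 0 1)
        (stringPart k (2*b) 0 0) (stringPart k (2*b) 0 1))
      (tensorOdd k (stringPart k (2*a+1) 0 0) (stringPart k (2*a+1) 0 1)
        (stringPart k (2*b) 0 0) (stringPart k (2*b) 0 1))
      z
      (multiPart k
        (fun i : Fin (a + b - min ((a:ℤ)-(b:ℤ)).natAbs ((a:ℤ)-(b:ℤ)+1).natAbs + 1) =>
          2*(min ((a:ℤ)-(b:ℤ)).natAbs ((a:ℤ)-(b:ℤ)+1).natAbs + i.1) + 1)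
        (fun i => (a + b - (min ((a:ℤ)-(b:ℤ)).natAbs ((a:ℤ)-(b:ℤ)+1).natAbs + i.1)) % 2) 0)
      (multiPart k
        (fun i : Fin (a + b - min ((a:ℤ)-(b:ℤ)).natAbs ((a:ℤ)-(b:ℤ)+1).natAbs + 1) =>
          2*(min ((a:ℤ)-(b:ℤ)).natAbs ((a:ℤ)-(b:ℤ)+1).natAbs + i.1) + 1)
        (fun i => (a + b - (min ((a:ℤ)-(b:ℤ)).natAbs ((a:ℤ)-(b:ℤ)+1).natAbs + i.1)) % 2) 1)
      (multiShift k
        (fun i : Fin (a + b - min ((a:ℤ)-(b:ℤ)).natAbs ((a:ℤ)-(b:ℤ)+1).natAbs + 1) =>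
          2*(min ((a:ℤ)-(b:ℤ)).natAbs ((a:ℤ)-(b:ℤ)+1).natAbs + i.1) + 1)) := by
  rw [z_eq _ _ z hz]
  set μ := min ((a:ℤ)-(b:ℤ)).natAbs ((a:ℤ)-(b:ℤ)+1).natAbs with hμ
  have hcase : (b ≤ a ∧ μ + b = a) ∨ (a < b ∧ μ + a + 1 = b) := by omega
  clear_value μ
  refine cg_assemble a b (a + b - μ + 1) _ _ (fun i => a + b - (μ + i.1)) ?_ ?_ ?_ ?_ ?_ ?_
  · intro i j h
    have := i.2
    have := j.2
    simp only at h
    exact Fin.ext (by omega)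
  · intro i
    have hi := i.2
    change a + b - (μ + i.1) ≤ _
    omega
  · intro i
    have hi := i.2
    change a + b - (μ + i.1) ≤ _
    omega
  · intro i
    have := i.2
    change 2 * (μ + i.1) + 1 + 2 * (a + b - (μ + i.1)) = _
    omega
  · intro i
    rfl
  · rw [cg_sum]
    rcases hcase with ⟨h, rfl⟩ | ⟨h, rfl⟩
    · rw [show μ + b + b - μ + 1 = 2*b+1 by omega]
      ring
    · rw [show a + (μ + a + 1) - μ + 1 = 2*a+2 by omega]
      ring
end

section
/- Let k be a field of characteristic zero, and let V = k³ be the vector superspace with V₀ spanned by the first standard basis vector e₁ and V₁ spanned by e₂ and e₃. Let a, b, c, d ∈ k with ac + bd = 0, and let X be the odd endomorphism of V given by the matrix with rows (0, a, b), (c, 0, 0), (d, 0, 0) (which is nilpotent). Then the pair (V, X) is neat if and only if X = 0 or both (a, b) ≠ (0, 0) and (c, d) ≠ (0, 0). [Characterization of the neat elements of gl(1|2) acting on the standard representation k^{1|2}.] -/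
open scoped TensorProduct

/-- The even part of `k^{1|2} = k³`: spanned by the first standard basis vector. -/
def gl12Even (k : Type*) [Field k] : Submodule k (Fin 3 → k) :=
  Submodule.pi Set.univ (fun j => if j = (0 : Fin 3) then (⊤ : Submodule k k) else ⊥)

/-- The odd part of `k^{1|2} = k³`: spanned by the second and third standard basis vectors. -/
def gl12Odd (k : Type*) [Field k] : Submodule k (Fin 3 → k) :=
  Submodule.pi Set.univ (fun j => if j = (0 : Fin 3) then (⊥ : Submodule k k) else ⊤)

theorem mem_gl12Even {k : Type*} [Field k] (v : Fin 3 → k) :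
    v ∈ gl12Even k ↔ v 1 = 0 ∧ v 2 = 0 := by
  simp [gl12Even, Submodule.mem_pi, Fin.forall_fin_succ]

theorem mem_gl12Odd {k : Type*} [Field k] (v : Fin 3 → k) :
    v ∈ gl12Odd k ↔ v 0 = 0 := by
  simp [gl12Odd, Submodule.mem_pi, Fin.forall_fin_succ]

theorem gl12_graded {k : Type*} [Field k] : (⊤ : Submodule k (Fin 3 → k)) =
    (⊤ ⊓ gl12Even k) ⊔ (⊤ ⊓ gl12Odd k) := by
  symm
  rw [eq_top_iff]
  intro v _
  rw [top_inf_eq, top_inf_eq, Submodule.mem_sup]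
  refine ⟨![v 0, 0, 0], ?_, ![0, v 1, v 2], ?_, ?_⟩
  · simp [mem_gl12Even]
  · simp [mem_gl12Odd]
  · ext j; fin_cases j <;> simp

theorem neat_sq_zero {k V : Type*} [Field k] [AddCommGroup V] [Module k V]
    (V0 V1 : Submodule k V) (x : V →ₗ[k] V) (h : IsNeat k V0 V1 x)
    (h2 : ∀ v, x (x v) = 0) : x = 0 := by
  obtain ⟨m, U, hU, h⟩ := h
  have htop := hU.submodule_iSup_eq_top
  have key : ∀ i, U i ≤ LinearMap.ker x := by
    intro i v hv
    obtain ⟨-, hx, n, ε, -, hn, φ, -, -, hφ⟩ := h i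
    have hs2 : ∀ w, shiftMap k n (shiftMap k n w) = 0 := by
      intro w
      obtain ⟨u, rfl⟩ := φ.surjective w
      rw [← hφ, ← hφ]
      have : (x.restrict hx) ((x.restrict hx) u) = 0 := by
        ext; simp [h2]
      rw [this, map_zero]
    have hn0 : n = 0 := by
      by_contra hne
      have h2n : 2 < n + 1 := by
        obtain ⟨r, rfl⟩ := hn
        omega
      have := congrFun (hs2 (fun _ => 1)) ⟨2, h2n⟩
      simp [shiftMap] at this
    subst hn0
    have hv' := hφ ⟨v, hv⟩
    have hz : ∀ w, shiftMap k 0 w = 0 := by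
      intro w
      ext j
      simp [shiftMap]
    rw [hz] at hv'
    have h3 := (LinearEquiv.map_eq_zero_iff φ).1 hv'
    simpa using congrArg Subtype.val h3
  ext v
  have : v ∈ LinearMap.ker x := (iSup_le key) (htop ▸ Submodule.mem_top)
  simpa using this

theorem neat_zero {k : Type*} [Field k] : IsNeat k (gl12Even k) (gl12Odd k) 0 := by
  have hb := (Pi.basisFun k (Fin 3)).linearIndependent
  refine ⟨3, fun i => Submodule.span k {Pi.basisFun k (Fin 3) i}, ?_, ?_⟩
  · rw [DirectSum.isInternal_submodule_iff_iSupIndep_and_iSup_eq_top]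
    refine ⟨hb.iSupIndep_span_singleton, ?_⟩
    rw [← Submodule.span_range_eq_iSup]
    exact (Pi.basisFun k (Fin 3)).span_eq
  · intro i
    have hmem : ∀ (u : Fin 3 → k), u ∈ Submodule.span k {Pi.basisFun k (Fin 3) i} →
        ∀ j, j ≠ i → u j = 0 := by
      intro u hu j hj
      obtain ⟨r, rfl⟩ := Submodule.mem_span_singleton.1 hu
      simp [hj]
    refine ⟨?_, by simp, 0, if i = 0 then 0 else 1, by split_ifs <;> simp, by simp, ?_⟩
    · by_cases hi : i = 0
      · have : Submodule.span k {Pi.basisFun k (Fin 3) i} ≤ gl12Even k := by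
          intro u hu
          rw [mem_gl12Even]
          subst hi
          exact ⟨hmem u hu _ (by decide), hmem u hu _ (by decide)⟩
        apply le_antisymm
        · rw [inf_eq_left.2 this]; exact le_sup_left
        · exact sup_le inf_le_left inf_le_left
      · have : Submodule.span k {Pi.basisFun k (Fin 3) i} ≤ gl12Odd k := by
          intro u hu
          rw [mem_gl12Odd]
          exact hmem u hu _ (Ne.symm hi)
        apply le_antisymm
        · rw [inf_eq_left.2 this]; exact le_sup_right
        · exact sup_le inf_le_left inf_le_left
    · refine ⟨(LinearEquiv.toSpanNonzeroSingleton k _ _ (hb.ne_zero i)).symm.trans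
        (LinearEquiv.funUnique (Fin 1) k k).symm, ?_, ?_, ?_⟩
      · rintro ⟨u, hu⟩ hu0
        by_cases hi : i = 0
        · simp [stringPart, hi, Submodule.mem_pi]
        · have hz : u = 0 := by
            rw [Submodule.mem_comap, Submodule.subtype_apply, mem_gl12Even] at hu0
            ext j
            have := hmem u hu 0 (Ne.symm hi)
            fin_cases j
            · exact this
            · exact hu0.1
            · exact hu0.2
          subst hz
          have : (⟨0, hu⟩ : Submodule.span k {Pi.basisFun k (Fin 3) i}) = 0 := rfl
          rw [this, map_zero]
          exact Submodule.zero_mem _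
      · rintro ⟨u, hu⟩ hu0
        by_cases hi : i = 0
        · have hz : u = 0 := by
            rw [Submodule.mem_comap, Submodule.subtype_apply, mem_gl12Odd] at hu0
            subst hi
            ext j
            fin_cases j
            · exact hu0
            · exact hmem u hu _ (by decide)
            · exact hmem u hu _ (by decide)
          subst hz
          have : (⟨0, hu⟩ : Submodule.span k {Pi.basisFun k (Fin 3) i}) = 0 := rfl
          rw [this, map_zero]
          exact Submodule.zero_mem _
        · simp [stringPart, hi, Submodule.mem_pi]
      · intro u
        have hz : ∀ w, shiftMap k 0 w = 0 := by
          intro w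
          ext j
          simp [shiftMap]
        rw [hz]
        have : ((0 : (Fin 3 → k) →ₗ[k] (Fin 3 → k)).restrict
          (p := Submodule.span k {Pi.basisFun k (Fin 3) i})
          (q := Submodule.span k {Pi.basisFun k (Fin 3) i}) (by simp)) u = 0 := by
          ext; simp
        rw [this, map_zero]

theorem neat_of_equiv {k : Type*} [Field k] (X : (Fin 3 → k) →ₗ[k] (Fin 3 → k))
    (φ : (Fin 3 → k) ≃ₗ[k] (Fin 3 → k))
    (h0 : ∀ v ∈ gl12Even k, φ v 0 = 0 ∧ φ v 2 = 0)
    (h1 : ∀ v ∈ gl12Odd k, φ v 1 = 0)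
    (h : ∀ v, φ (X v) = ![0, φ v 0, φ v 1]) :
    IsNeat k (gl12Even k) (gl12Odd k) X := by
  refine ⟨1, fun _ => ⊤, ?_, ?_⟩
  · rw [DirectSum.isInternal_submodule_iff_iSupIndep_and_iSup_eq_top]
    refine ⟨?_, by simp⟩
    intro i
    have : ∀ j : Fin 1, j = i := fun j => Subsingleton.elim _ _
    simp [this]
  · intro _
    refine ⟨gl12_graded, by simp, 2, 1, le_refl _, even_two, Submodule.topEquiv.trans φ, ?_, ?_, ?_⟩
    · intro v hv
      have := h0 v hv
      simp [stringPart, Submodule.mem_pi, Fin.forall_fin_succ, this]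
    · intro v hv
      have := h1 v hv
      simp [stringPart, Submodule.mem_pi, Fin.forall_fin_succ, this]
    · intro v
      have := h v
      simp only [LinearEquiv.trans_apply, Submodule.topEquiv_apply, LinearMap.coe_restrict_apply]
      rw [this]
      ext j
      fin_cases j <;> simp [shiftMap]

/-- **Characterization of the neat elements of `gl(1|2)` on the standard representation**:
the odd nilpotent element `X = !![0, a, b; c, 0, 0; d, 0, 0]` (with `ac + bd = 0`) acts neatly
on `k^{1|2}` iff `X = 0` or both `(a, b) ≠ (0, 0)` and `(c, d) ≠ (0, 0)`. -/
theorem neat_criterion_gl12 {k : Type*} [Field k] [CharZero k] (a b c d : k)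
    (hnilcone : a * c + b * d = 0)
    (X : (Fin 3 → k) →ₗ[k] (Fin 3 → k))
    (hX : X = Matrix.toLin' !![0, a, b; c, 0, 0; d, 0, 0]) :
    IsNeat k (gl12Even k) (gl12Odd k) X ↔
      (X = 0 ∨ (¬(a = 0 ∧ b = 0) ∧ ¬(c = 0 ∧ d = 0))) := by
  have hXv : ∀ v, X v = ![a * v 1 + b * v 2, c * v 0, d * v 0] := by
    intro v
    subst hX
    ext j
    fin_cases j <;> simp [Matrix.mulVec, dotProduct, Fin.sum_univ_succ]
  constructor
  · intro h
    by_contra! hc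
    obtain ⟨hne, hc⟩ := hc
    apply hne
    refine neat_sq_zero _ _ X h ?_
    intro v
    have hm : a * c = 0 ∧ a * d = 0 ∧ b * c = 0 ∧ b * d = 0 := by
      by_cases hab : a = 0 ∧ b = 0
      · simp [hab]
      · have := hc (by simpa using hab)
        simp [this]
    obtain ⟨m1, m2, m3, m4⟩ := hm
    rw [hXv, hXv]
    ext j
    fin_cases j
    · simp; linear_combination v 0 * hnilcone
    · simp [-mul_eq_zero]; linear_combination v 1 * m1 + v 2 * m3
    · simp [-mul_eq_zero]; linear_combination v 1 * m2 + v 2 * m4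
  · rintro (h | ⟨hab, hcd⟩)
    · rw [h]; exact neat_zero
    · by_cases ha : a = 0
      · have hb : b ≠ 0 := fun hb => hab ⟨ha, hb⟩
        have hd : d = 0 := by
          have : b * d = 0 := by simpa [ha] using hnilcone
          exact (mul_eq_zero.1 this).resolve_left hb
        have hc : c ≠ 0 := fun hc => hcd ⟨hc, hd⟩
        subst ha hd
        let φ : (Fin 3 → k) ≃ₗ[k] (Fin 3 → k) :=
          { toFun := fun v => ![v 2, v 0 / b, v 1 / (b * c)]
            invFun := fun f => ![b * f 1, b * c * f 2, f 0]
            map_add' := by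
              intro u v; ext j; fin_cases j <;> simp <;> ring
            map_smul' := by
              intro u v; ext j; fin_cases j <;> simp <;> ring
            left_inv := by
              intro v; ext j; fin_cases j <;> simp <;> field_simp
            right_inv := by
              intro v; ext j; fin_cases j <;> simp <;> field_simp }
        have hφ : ∀ v, φ v = ![v 2, v 0 / b, v 1 / (b * c)] := fun _ => rfl
        refine neat_of_equiv X φ ?_ ?_ ?_
        · intro v hv
          rw [mem_gl12Even] at hv
          simp [hφ, hv]
        · intro v hv
          rw [mem_gl12Odd] at hv
          simp [hφ, hv]
        · intro v
          rw [hXv, hφ, hφ]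
          ext j; fin_cases j <;> simp <;> field_simp
      · have hd : d ≠ 0 := by
          intro hd
          have : a * c = 0 := by simpa [hd] using hnilcone
          exact hcd ⟨(mul_eq_zero.1 this).resolve_left ha, hd⟩
        let φ : (Fin 3 → k) ≃ₗ[k] (Fin 3 → k) :=
          { toFun := fun v => ![v 1 - c * v 2 / d, v 0 / a, v 2 / (a * d)]
            invFun := fun f => ![a * f 1, f 0 + a * c * f 2, a * d * f 2]
            map_add' := by
              intro u v; ext j; fin_cases j <;> simp <;> ring
            map_smul' := by
              intro u v; ext j; fin_cases j <;> simp <;> ring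
            left_inv := by
              intro v; ext j; fin_cases j <;> simp <;> field_simp <;> ring
            right_inv := by
              intro v; ext j; fin_cases j <;> simp <;> field_simp <;> ring }
        have hφ : ∀ v, φ v = ![v 1 - c * v 2 / d, v 0 / a, v 2 / (a * d)] := fun _ => rfl
        refine neat_of_equiv X φ ?_ ?_ ?_
        · intro v hv
          rw [mem_gl12Even] at hv
          simp [hφ, hv]
        · intro v hv
          rw [mem_gl12Odd] at hv
          simp [hφ, hv]
        · intro v
          rw [hXv, hφ, hφ]
          ext j; fin_cases j
          · simp; field_simp; ring
          · simp; field_simp; linear_combination v 2 * hnilcone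
          · simp; field_simp
end
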